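/- arXiv:0905.3036 — 6 statements merged into one kernel-verified Lean document; each statement's English description precedes it below -/
import Mathlib

section
/- Let X be a finite-dimensional smooth real Banach space and let D be a dictionary in X. Then there exists δ > 0 such that for every y ∈ X with ‖y‖ = 1 one has sup_{φ ∈ D} |F_y(φ)| ≥ δ. -/
/-- On a compact set of functionals none of which vanishes identically on `D`, the quantities
`sup_{φ ∈ D} |G φ|` are bounded away from zero. -/
theorem IsCompact.exists_pos_forall_exists_le_abs_apply {X : Type*} [NormedAddCommGroup X]
    [NormedSpace ℝ X] {D : Set X} {K : Set (X →L[ℝ] ℝ)} (hK : IsCompact K)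
    (hD : ∀ G ∈ K, ∃ φ ∈ D, G φ ≠ 0) :
    ∃ δ > 0, ∀ G ∈ K, ∃ φ ∈ D, δ ≤ |G φ| := by
  refine hK.induction_on (p := fun s => ∃ δ > 0, ∀ G ∈ s, ∃ φ ∈ D, δ ≤ |G φ|)
    ⟨1, one_pos, by simp⟩ ?_ ?_ ?_
  · rintro s t hst ⟨δ, hδ, h⟩
    exact ⟨δ, hδ, fun G hG => h G (hst hG)⟩
  · rintro s t ⟨δ, hδ, hs⟩ ⟨ε, hε, ht⟩
    refine ⟨min δ ε, lt_min hδ hε, ?_⟩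
    rintro G (hG | hG)
    · obtain ⟨φ, hφ, h⟩ := hs G hG
      exact ⟨φ, hφ, (min_le_left _ _).trans h⟩
    · obtain ⟨φ, hφ, h⟩ := ht G hG
      exact ⟨φ, hφ, (min_le_right _ _).trans h⟩
  · intro G hG
    obtain ⟨φ, hφ, hne⟩ := hD G hG
    have hpos : 0 < |G φ| := abs_pos.mpr hne
    have hcont : Continuous fun H : X →L[ℝ] ℝ => |H φ| := by fun_prop
    refine ⟨{H | |G φ| / 2 < |H φ|}, mem_nhdsWithin_of_mem_nhds
      ((isOpen_lt continuous_const hcont).mem_nhds (half_lt_self hpos)),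
      |G φ| / 2, half_pos hpos, fun H hH => ⟨φ, hφ, le_of_lt hH⟩⟩

/-- If `D` consists of unit vectors, each `|G φ|` with `φ ∈ D` is at most the supremum over `D`. -/
theorem ContinuousLinearMap.abs_apply_le_biSup {X : Type*} [NormedAddCommGroup X]
    [NormedSpace ℝ X] {D : Set X} (hD : ∀ φ ∈ D, ‖φ‖ = 1) (G : X →L[ℝ] ℝ) {φ : X} (hφ : φ ∈ D) :
    |G φ| ≤ ⨆ ψ ∈ D, |G ψ| := by
  have hbdd : BddAbove (Set.range fun ψ : X => ⨆ _ : ψ ∈ D, |G ψ|) := by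
    refine ⟨‖G‖, ?_⟩
    rintro _ ⟨ψ, rfl⟩
    refine Real.iSup_le (fun hψ => ?_) (norm_nonneg G)
    simpa [hD ψ hψ] using G.le_opNorm ψ
  refine le_trans ?_ (le_ciSup hbdd φ)
  simp [hφ]

/-- In a finite-dimensional smooth real Banach space with a dictionary
`D` (unit vectors with dense linear span), there is `δ > 0` such that
`sup_{φ ∈ D} |F_y(φ)| ≥ δ` for every unit vector `y`. -/
theorem stmt_1 {X : Type*} [NormedAddCommGroup X] [NormedSpace ℝ X]
    [FiniteDimensional ℝ X]
    (F : X → X →L[ℝ] ℝ)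
    (hnorming : ∀ x : X, x ≠ 0 → ‖F x‖ = 1 ∧ F x x = ‖x‖)
    (hsmooth : ∀ x : X, x ≠ 0 → ∀ G : X →L[ℝ] ℝ, ‖G‖ = 1 → G x = ‖x‖ → G = F x)
    (D : Set X) (hD1 : ∀ φ ∈ D, ‖φ‖ = 1)
    (hD2 : Dense (Submodule.span ℝ D : Set X)) :
    ∃ δ > 0, ∀ y : X, ‖y‖ = 1 → δ ≤ ⨆ φ ∈ D, |F y φ| := by
  have : ProperSpace (X →L[ℝ] ℝ) := FiniteDimensional.proper ℝ _
  obtain ⟨δ, hδ, h⟩ := (isCompact_sphere (0 : X →L[ℝ] ℝ) 1).exists_pos_forall_exists_le_abs_apply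
    (D := D) (by
      intro G hG
      by_contra! hzero
      have hG0 : G = 0 := ContinuousLinearMap.ext_on hD2 fun φ hφ => by simpa using hzero φ hφ
      simp [hG0] at hG)
  refine ⟨δ, hδ, fun y hy => ?_⟩
  have hy0 : y ≠ 0 := norm_ne_zero_iff.mp (by simp [hy])
  obtain ⟨φ, hφ, hle⟩ := h (F y) (by simpa using (hnorming y hy0).1)
  exact hle.trans ((F y).abs_apply_le_biSup hD1 hφ)
end

section
/- Let X be a finite-dimensional smooth real Banach space, let D be a dictionary in X, and let τ ∈ (0,1]. Then there exists γ ∈ (0,1) such that for every nonzero y ∈ X and every φ ∈ D satisfying |F_y(φ)| ≥ τ·sup_{ψ ∈ D} |F_y(ψ)|, one has inf_{λ ∈ ℝ} ‖y − λφ‖ ≤ γ·‖y‖. -/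
/-- A spanning set of a finite-dimensional space is uniformly norming up to a positive constant. -/
lemma exists_pos_le_of_span_eq_top {X : Type*} [NormedAddCommGroup X] [NormedSpace ℝ X]
    [FiniteDimensional ℝ X] {D : Set X} (hD : Submodule.span ℝ D = ⊤) :
    ∃ c : ℝ, 0 < c ∧ ∀ (G : X →L[ℝ] ℝ) (s : ℝ), ‖G‖ = 1 → 0 ≤ s →
      (∀ ψ ∈ D, |G ψ| ≤ s) → c ≤ s := by
  obtain ⟨b, hbD, hspan, hli⟩ := exists_linearIndependent ℝ D
  have : Fintype b := hli.setFinite.fintype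
  let T : (X →L[ℝ] ℝ) →ₗ[ℝ] (b → ℝ) :=
    { toFun := fun G i => G i
      map_add' := fun _ _ => rfl
      map_smul' := fun _ _ => rfl }
  have hT : LinearMap.ker T = ⊥ := by
    refine LinearMap.ker_eq_bot'.2 fun G hG => ?_
    have hzero : (G : X →ₗ[ℝ] ℝ) = 0 :=
      LinearMap.ext_on (hspan.trans hD) fun x hx => congrFun hG ⟨x, hx⟩
    ext x
    exact LinearMap.congr_fun hzero x
  obtain ⟨K, hK, hanti⟩ := T.exists_antilipschitzWith hT
  refine ⟨(K : ℝ)⁻¹, inv_pos.2 (by exact_mod_cast hK), fun G s hG hs hle => ?_⟩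
  have hnorm : ‖T G‖ ≤ s :=
    (pi_norm_le_iff_of_nonneg hs).2 fun i => hle i (hbD i.2)
  have hbound := hanti.le_mul_dist G 0
  rw [map_zero, dist_zero_right, dist_zero_right, hG] at hbound
  have hKpos : (0 : ℝ) < K := by exact_mod_cast hK
  rw [inv_le_iff_one_le_mul₀' hKpos]
  exact hbound.trans (by gcongr)

/-- If no multiple of `φ` brings the unit vector `y` strictly inside the unit ball, then `y` has a
norming functional that vanishes at `φ`. -/
lemma exists_norming_apply_eq_zero {X : Type*} [NormedAddCommGroup X] [NormedSpace ℝ X]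
    {y φ : X} (hy : ‖y‖ = 1) (hdist : ∀ r : ℝ, 1 ≤ ‖y - r • φ‖) :
    ∃ H : X →L[ℝ] ℝ, ‖H‖ = 1 ∧ H y = 1 ∧ H φ = 0 := by
  let S : Submodule ℝ X := Submodule.span ℝ {φ}
  have : IsClosed (S : Set X) := S.closed_of_finiteDimensional
  obtain ⟨g, hg, hgy⟩ := exists_dual_vector'' ℝ (S.mkQ y)
  have hquot : 1 ≤ ‖S.mkQ y‖ := by
    refine le_of_forall_pos_lt_add fun ε hε => ?_
    obtain ⟨m, hm, hlt⟩ := Submodule.Quotient.norm_mk_lt (S.mkQ y) hε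
    obtain ⟨r, hr⟩ := Submodule.mem_span_singleton.1 ((Submodule.Quotient.eq S).1 hm.symm)
    have hmy : m = y - r • φ := by rw [hr]; abel
    exact ((hdist r).trans_eq (by rw [hmy])).trans_lt hlt
  have hbound : ∀ x : X, ‖g (S.mkQ x)‖ ≤ 1 * ‖x‖ := fun x =>
    (g.le_of_opNorm_le hg _).trans (by gcongr; exact Submodule.Quotient.norm_mk_le S x)
  let H : X →L[ℝ] ℝ := ((g : (X ⧸ S) →ₗ[ℝ] ℝ).comp S.mkQ).mkContinuous 1 hbound
  have hHy : 1 ≤ H y := hquot.trans_eq hgy.symm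
  have hHle : ‖H‖ ≤ 1 := LinearMap.mkContinuous_norm_le _ zero_le_one _
  have hHy' : H y ≤ ‖H‖ := by
    simpa [hy] using (le_abs_self _).trans (H.le_opNorm y)
  refine ⟨H, by linarith, by linarith, ?_⟩
  have hφ : S.mkQ φ = 0 := (Submodule.Quotient.mk_eq_zero S).2 (Submodule.mem_span_singleton_self φ)
  change g (S.mkQ φ) = 0
  rw [hφ, map_zero]

/-- In a finite-dimensional smooth space, moving a unit vector along a unit direction on which its
norming functional is at least `c` in absolute value reduces the norm by a uniform factor. -/
lemma exists_uniform_norm_reduction {X : Type*} [NormedAddCommGroup X] [NormedSpace ℝ X]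
    [FiniteDimensional ℝ X]
    (hsmooth : ∀ y : X, ‖y‖ = 1 → ∀ G H : X →L[ℝ] ℝ,
      ‖G‖ = 1 → G y = 1 → ‖H‖ = 1 → H y = 1 → G = H)
    {c : ℝ} (hc : 0 < c) :
    ∃ γ : ℝ, γ < 1 ∧ ∀ (y φ : X) (G : X →L[ℝ] ℝ), ‖y‖ = 1 → ‖φ‖ = 1 → ‖G‖ = 1 → G y = 1 →
      c ≤ |G φ| → ∃ r : ℝ, ‖y - r • φ‖ ≤ γ := by
  let A : Set (X × X × (X →L[ℝ] ℝ)) :=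
    (Metric.sphere 0 1 ×ˢ Metric.sphere 0 1 ×ˢ Metric.sphere 0 1) ∩
      {p | p.2.2 p.1 = 1 ∧ c ≤ |p.2.2 p.2.1|}
  have hA : IsCompact A := by
    refine ((isCompact_sphere _ _).prod
      ((isCompact_sphere _ _).prod (isCompact_sphere _ _))).inter_right ?_
    have heq : IsClosed {p : X × X × (X →L[ℝ] ℝ) | p.2.2 p.1 = 1} :=
      isClosed_eq (by fun_prop) (by fun_prop)
    have hle : IsClosed {p : X × X × (X →L[ℝ] ℝ) | c ≤ |p.2.2 p.2.1|} :=
      isClosed_le (by fun_prop) (by fun_prop)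
    exact heq.inter hle
  obtain ⟨γ, hγ, hA'⟩ : ∃ γ : ℝ, γ < 1 ∧ ∀ p ∈ A, ∃ r : ℝ, ‖p.1 - r • p.2.1‖ ≤ γ := by
    refine hA.induction_on (p := fun s => ∃ γ : ℝ, γ < 1 ∧ ∀ p ∈ s, ∃ r : ℝ,
      ‖p.1 - r • p.2.1‖ ≤ γ) ⟨0, zero_lt_one, by simp⟩ ?_ ?_ ?_
    · rintro s t hst ⟨γ, hγ, h⟩
      exact ⟨γ, hγ, fun p hp => h p (hst hp)⟩
    · rintro s t ⟨γ₁, hγ₁, h₁⟩ ⟨γ₂, hγ₂, h₂⟩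
      refine ⟨max γ₁ γ₂, max_lt hγ₁ hγ₂, ?_⟩
      rintro p (hp | hp)
      · exact (h₁ p hp).imp fun r hr => hr.trans (le_max_left _ _)
      · exact (h₂ p hp).imp fun r hr => hr.trans (le_max_right _ _)
    · rintro ⟨y, φ, G⟩ ⟨⟨hy, hφ, hG⟩, hGy, hGφ⟩
      rw [mem_sphere_zero_iff_norm] at hy hφ hG
      obtain ⟨r, hr⟩ : ∃ r : ℝ, ‖y - r • φ‖ < 1 := by
        by_contra! hdist
        obtain ⟨H, hH, hHy, hHφ⟩ := exists_norming_apply_eq_zero hy hdist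
        obtain rfl := hsmooth y hy G H hG hGy hH hHy
        exact hc.not_ge (by simpa [hHφ] using hGφ)
      obtain ⟨γ, hrγ, hγ⟩ := exists_between hr
      have hopen : IsOpen {p : X × X × (X →L[ℝ] ℝ) | ‖p.1 - r • p.2.1‖ < γ} :=
        isOpen_lt (by fun_prop) (by fun_prop)
      exact ⟨_, mem_nhdsWithin_of_mem_nhds (hopen.mem_nhds hrγ), γ, hγ,
        fun p hp => ⟨r, le_of_lt hp⟩⟩
  refine ⟨γ, hγ, fun y φ G hy hφ hG hGy hGφ => hA' (y, φ, G) ⟨⟨?_, ?_, ?_⟩, hGy, hGφ⟩⟩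
  all_goals simpa

/-- Weak Dual Greedy step in a finite-dimensional smooth real Banach
space with dictionary `D` and weakness parameter `τ ∈ (0,1]` is norm-reducing:
there is `γ ∈ (0,1)` such that whenever `φ ∈ D` satisfies
`|F_y(φ)| ≥ τ·sup_{ψ ∈ D} |F_y(ψ)|` for a nonzero `y`, the best one-term
approximation in direction `φ` satisfies `inf_λ ‖y − λφ‖ ≤ γ‖y‖`. -/
theorem stmt_2 {X : Type*} [NormedAddCommGroup X] [NormedSpace ℝ X]
    [FiniteDimensional ℝ X]
    (F : X → X →L[ℝ] ℝ)
    (hnorming : ∀ x : X, x ≠ 0 → ‖F x‖ = 1 ∧ F x x = ‖x‖)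
    (hsmooth : ∀ x : X, x ≠ 0 → ∀ G : X →L[ℝ] ℝ, ‖G‖ = 1 → G x = ‖x‖ → G = F x)
    (D : Set X) (hD1 : ∀ φ ∈ D, ‖φ‖ = 1)
    (hD2 : Dense (Submodule.span ℝ D : Set X))
    (τ : ℝ) (hτ0 : 0 < τ) (hτ1 : τ ≤ 1) :
    ∃ γ : ℝ, 0 < γ ∧ γ < 1 ∧
      ∀ y : X, y ≠ 0 → ∀ φ ∈ D,
        τ * (⨆ ψ ∈ D, |F y ψ|) ≤ |F y φ| →
        (⨅ lam : ℝ, ‖y - lam • φ‖) ≤ γ * ‖y‖ := by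
  have hspan : Submodule.span ℝ D = ⊤ := by
    rw [← (Submodule.span ℝ D).closed_of_finiteDimensional.submodule_topologicalClosure_eq]
    exact Submodule.dense_iff_topologicalClosure_eq_top.1 hD2
  obtain ⟨c, hc, hcle⟩ := exists_pos_le_of_span_eq_top hspan
  have hunique : ∀ y : X, ‖y‖ = 1 → ∀ G H : X →L[ℝ] ℝ,
      ‖G‖ = 1 → G y = 1 → ‖H‖ = 1 → H y = 1 → G = H := by
    intro y hy G H hG hGy hH hHy
    have hy0 : y ≠ 0 := norm_ne_zero_iff.1 (by simp [hy])
    rw [hsmooth y hy0 G hG (hGy.trans hy.symm), hsmooth y hy0 H hH (hHy.trans hy.symm)]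
  obtain ⟨γ, hγ, hred⟩ := exists_uniform_norm_reduction hunique (mul_pos hτ0 hc)
  refine ⟨max γ 2⁻¹, by positivity, max_lt hγ (by norm_num), fun y hy φ hφ hweak => ?_⟩
  obtain ⟨hF, hFy⟩ := hnorming y hy
  have hy0 : 0 < ‖y‖ := norm_pos_iff.2 hy
  have hle : ∀ ψ ∈ D, |F y ψ| ≤ 1 := fun ψ hψ => by
    simpa [hF, hD1 ψ hψ] using (F y).le_opNorm ψ
  have hbdd : BddAbove (Set.range fun ψ => ⨆ _ : ψ ∈ D, |F y ψ|) := by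
    refine ⟨1, ?_⟩
    rintro _ ⟨ψ, rfl⟩
    exact Real.iSup_le (hle ψ) zero_le_one
  have hsup : c ≤ ⨆ ψ ∈ D, |F y ψ| := by
    refine hcle (F y) _ hF
      (Real.iSup_nonneg fun ψ => Real.iSup_nonneg fun _ => abs_nonneg _) fun ψ hψ => ?_
    refine le_trans ?_ (le_ciSup hbdd ψ)
    simp [hψ]
  obtain ⟨r, hr⟩ := hred (‖y‖⁻¹ • y) φ (F y) (by rw [norm_smul, norm_inv, norm_norm, inv_mul_cancel₀ hy0.ne']) (hD1 φ hφ) hF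
    (by rw [map_smul, hFy, smul_eq_mul, inv_mul_cancel₀ hy0.ne'])
    ((mul_le_mul_of_nonneg_left hsup hτ0.le).trans hweak)
  have hinf : (⨅ lam : ℝ, ‖y - lam • φ‖) ≤ ‖y - (‖y‖ * r) • φ‖ :=
    ciInf_le ⟨0, by rintro _ ⟨_, rfl⟩; exact norm_nonneg _⟩ (‖y‖ * r)
  have hscale : y - (‖y‖ * r) • φ = ‖y‖ • (‖y‖⁻¹ • y - r • φ) := by
    rw [smul_sub, smul_inv_smul₀ hy0.ne', mul_smul]
  refine hinf.trans ?_
  rw [hscale, norm_smul, norm_norm, mul_comm]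
  gcongr
  exact hr.trans (le_max_left _ _)
end

section
/- Let X be a finite-dimensional smooth real Banach space and let D be a dictionary in X. Then there exists γ ∈ (0,1) such that for every nonzero y ∈ X one has inf{‖y − λφ‖ : λ ∈ ℝ, φ ∈ D} ≤ γ·‖y‖. -/
/-- If no multiple of `φ` improves on `0` as an approximation of `y`, then some norming functional
of `y` vanishes at `φ`. -/
lemma exists_norming_functional_apply_eq_zero {X : Type*} [NormedAddCommGroup X] [NormedSpace ℝ X]
    {y φ : X} (hy : y ≠ 0) (h : ∀ lam : ℝ, ‖y‖ ≤ ‖y - lam • φ‖) :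
    ∃ G : X →L[ℝ] ℝ, ‖G‖ = 1 ∧ G y = ‖y‖ ∧ G φ = 0 := by
  let S : Submodule ℝ X := Submodule.span ℝ {φ}
  have : IsClosed (S : Set X) := Submodule.closed_of_finiteDimensional (Submodule.span ℝ {φ})
  have hmk : ‖(S.mkQ y : X ⧸ S)‖ = ‖y‖ := by
    refine le_antisymm (Submodule.Quotient.norm_mk_le S y) (le_of_forall_pos_lt_add ?_)
    intro ε hε
    obtain ⟨m, hm, hlt⟩ := Submodule.Quotient.norm_mk_lt (S := S) (S.mkQ y) hε
    have hmem : y - m ∈ S := (Submodule.Quotient.eq S).1 hm.symm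
    obtain ⟨c, hc⟩ := Submodule.mem_span_singleton.1 hmem
    have := h c
    rw [hc, sub_sub_cancel] at this
    exact this.trans_lt hlt
  obtain ⟨g, hg1, hg⟩ := exists_dual_vector'' ℝ (S.mkQ y)
  rw [hmk] at hg
  let G : X →L[ℝ] ℝ := (g.toLinearMap.comp S.mkQ).mkContinuous 1 fun x =>
    (g.le_of_opNorm_le hg1 _).trans (by gcongr; exact Submodule.Quotient.norm_mk_le S x)
  have hGy : G y = ‖y‖ := hg
  refine ⟨G, le_antisymm (LinearMap.mkContinuous_norm_le _ zero_le_one _) ?_, hGy, ?_⟩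
  · have hle := G.le_opNorm y
    rw [hGy, norm_norm] at hle
    exact le_of_mul_le_mul_right (by simpa using hle) (norm_pos_iff.2 hy)
  · have hφ : S.mkQ φ = 0 :=
      (Submodule.Quotient.mk_eq_zero S).2 (Submodule.mem_span_singleton_self φ)
    change g (S.mkQ φ) = 0
    rw [hφ, map_zero]

/-- In a smooth space every nonzero vector is strictly better approximated by a multiple of some
dictionary element than by `0`. -/
lemma exists_norm_sub_smul_lt_of_smooth {X : Type*} [NormedAddCommGroup X] [NormedSpace ℝ X]
    {D : Set X} (hD : Dense (Submodule.span ℝ D : Set X)) {y : X} (hy : y ≠ 0) {f : X →L[ℝ] ℝ}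
    (hf : f y = ‖y‖) (hunique : ∀ G : X →L[ℝ] ℝ, ‖G‖ = 1 → G y = ‖y‖ → G = f) :
    ∃ lam : ℝ, ∃ φ ∈ D, ‖y - lam • φ‖ < ‖y‖ := by
  by_contra! h
  have hzero : Set.EqOn f (0 : X →L[ℝ] ℝ) D := fun φ hφ => by
    obtain ⟨G, hG1, hGy, hGφ⟩ :=
      exists_norming_functional_apply_eq_zero hy fun lam => h lam φ hφ
    rw [← hunique G hG1 hGy, hGφ, zero_apply]
  have hf0 : f = 0 := ContinuousLinearMap.ext_on hD hzero
  rw [hf0, zero_apply] at hf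
  exact hy (norm_eq_zero.1 hf.symm)

/-- A pointwise strict improvement on a compact set of vectors is uniform. -/
lemma IsCompact.exists_uniform_norm_sub_smul_le {X : Type*} [NormedAddCommGroup X]
    [NormedSpace ℝ X] {D K : Set X} (hK : IsCompact K)
    (h : ∀ y ∈ K, ∃ lam : ℝ, ∃ φ ∈ D, ‖y - lam • φ‖ < 1) :
    ∃ γ : ℝ, 0 < γ ∧ γ < 1 ∧ ∀ y ∈ K, ∃ lam : ℝ, ∃ φ ∈ D, ‖y - lam • φ‖ ≤ γ := by
  refine hK.induction_on (p := fun s => ∃ γ : ℝ, 0 < γ ∧ γ < 1 ∧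
    ∀ y ∈ s, ∃ lam : ℝ, ∃ φ ∈ D, ‖y - lam • φ‖ ≤ γ) ?_ ?_ ?_ ?_
  · exact ⟨1 / 2, by norm_num, by norm_num, by simp⟩
  · rintro s t hst ⟨γ, h0, h1, ht⟩
    exact ⟨γ, h0, h1, fun y hy => ht y (hst hy)⟩
  · rintro s t ⟨a, ha0, ha1, hs⟩ ⟨b, hb0, hb1, ht⟩
    refine ⟨max a b, lt_max_of_lt_left ha0, max_lt ha1 hb1, ?_⟩
    rintro y (hy | hy)
    · obtain ⟨lam, φ, hφ, hle⟩ := hs y hy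
      exact ⟨lam, φ, hφ, hle.trans (le_max_left _ _)⟩
    · obtain ⟨lam, φ, hφ, hle⟩ := ht y hy
      exact ⟨lam, φ, hφ, hle.trans (le_max_right _ _)⟩
  · intro y hy
    obtain ⟨lam, φ, hφ, hlt⟩ := h y hy
    obtain ⟨γ, hγ, hγ1⟩ := exists_between hlt
    have hcont : Continuous fun z : X => ‖z - lam • φ‖ := by fun_prop
    exact ⟨{z | ‖z - lam • φ‖ < γ},
      mem_nhdsWithin_of_mem_nhds ((isOpen_lt hcont continuous_const).mem_nhds hγ),
      γ, (norm_nonneg _).trans_lt hγ, hγ1, fun z hz => ⟨lam, φ, hφ, le_of_lt hz⟩⟩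

/-- In a finite-dimensional smooth real Banach space with dictionary
`D`, there is `γ ∈ (0,1)` such that for every nonzero `y` the best one-term
approximation from the dictionary satisfies
`inf{‖y − λφ‖ : λ ∈ ℝ, φ ∈ D} ≤ γ‖y‖`. -/
theorem stmt_3 {X : Type*} [NormedAddCommGroup X] [NormedSpace ℝ X]
    [FiniteDimensional ℝ X]
    (F : X → X →L[ℝ] ℝ)
    (hnorming : ∀ x : X, x ≠ 0 → ‖F x‖ = 1 ∧ F x x = ‖x‖)
    (hsmooth : ∀ x : X, x ≠ 0 → ∀ G : X →L[ℝ] ℝ, ‖G‖ = 1 → G x = ‖x‖ → G = F x)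
    (D : Set X) (hD1 : ∀ φ ∈ D, ‖φ‖ = 1)
    (hD2 : Dense (Submodule.span ℝ D : Set X)) :
    ∃ γ : ℝ, 0 < γ ∧ γ < 1 ∧
      ∀ y : X, y ≠ 0 →
        sInf {r : ℝ | ∃ lam : ℝ, ∃ φ ∈ D, r = ‖y - lam • φ‖} ≤ γ * ‖y‖ := by
  have hpt : ∀ y ∈ Metric.sphere (0 : X) 1, ∃ lam : ℝ, ∃ φ ∈ D, ‖y - lam • φ‖ < 1 := by
    intro y hy
    have hy1 : ‖y‖ = 1 := mem_sphere_zero_iff_norm.1 hy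
    have hy0 : y ≠ 0 := norm_ne_zero_iff.1 (by simp [hy1])
    simpa only [hy1] using
      exists_norm_sub_smul_lt_of_smooth hD2 hy0 (hnorming y hy0).2 (hsmooth y hy0)
  have : ProperSpace X := FiniteDimensional.proper_real X
  obtain ⟨γ, h0, h1, hγ⟩ := (isCompact_sphere (0 : X) 1).exists_uniform_norm_sub_smul_le hpt
  refine ⟨γ, h0, h1, fun y hy => ?_⟩
  have hpos : 0 < ‖y‖ := norm_pos_iff.2 hy
  obtain ⟨lam, φ, hφ, hle⟩ := hγ (‖y‖⁻¹ • y) (by simp [norm_smul, hpos.ne'])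
  have hscale : y - (‖y‖ * lam) • φ = ‖y‖ • (‖y‖⁻¹ • y - lam • φ) := by
    rw [smul_sub, smul_inv_smul₀ hpos.ne', mul_smul]
  refine csInf_le_of_le ⟨0, ?_⟩ ⟨‖y‖ * lam, φ, hφ, rfl⟩ ?_
  · rintro r ⟨_, _, _, rfl⟩
    exact norm_nonneg _
  · rw [hscale, norm_smul, norm_norm, mul_comm]
    gcongr
end

section
/- In ℝ² with the Euclidean norm, let φ₁ = (1,0) and φ₂ = (1/√2, 1/√2). If x ∈ ℝ² is not a scalar multiple of φ₁ and not a scalar multiple of φ₂, then for each j ∈ {1,2} the vector x − ⟨x,φ_j⟩φ_j (which is the residual of the best one-term approximation of x in the direction φ_j) is nonzero and is again not a scalar multiple of φ₁ and not a scalar multiple of φ₂. Consequently, every XGA residual sequence for the dictionary D = {φ₁, φ₂} starting at such an x satisfies x_n ≠ 0 for all n. -/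
open RealInnerProductSpace

section Residual

variable {E : Type*} [NormedAddCommGroup E] [InnerProductSpace ℝ E] {φ ψ x : E}

theorem inner_residual_eq_zero (hφ : ‖φ‖ = 1) : ⟪x - ⟪x, φ⟫ • φ, φ⟫ = 0 := by
  simp [inner_sub_left, real_inner_smul_left, hφ]

theorem residual_ne_smul (hφ : ‖φ‖ = 1) (hψφ : ⟪ψ, φ⟫ ≠ 0) (hx : ¬ ∃ c : ℝ, x = c • φ) :
    ¬ ∃ c : ℝ, x - ⟪x, φ⟫ • φ = c • ψ := by
  rintro ⟨c, hc⟩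
  have h := inner_residual_eq_zero (x := x) hφ
  rw [hc, real_inner_smul_left] at h
  have hc0 : c = 0 := (mul_eq_zero.mp h).resolve_right hψφ
  rw [hc0, zero_smul] at hc
  exact hx ⟨_, sub_eq_zero.mp hc⟩

theorem norm_sub_smul_sq (hφ : ‖φ‖ = 1) (t : ℝ) :
    ‖x - t • φ‖ ^ 2 = ‖x - ⟪x, φ⟫ • φ‖ ^ 2 + (t - ⟪x, φ⟫) ^ 2 := by
  simp only [norm_sub_sq_real, real_inner_smul_right, norm_smul, hφ, mul_one, Real.norm_eq_abs,
    sq_abs]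
  ring

/-- The coefficient of the best approximation in a unit direction is the inner product. -/
theorem eq_inner_of_norm_sub_smul_le (hφ : ‖φ‖ = 1) {lam : ℝ}
    (h : ‖x - lam • φ‖ ≤ ‖x - ⟪x, φ⟫ • φ‖) : lam = ⟪x, φ⟫ := by
  have hsq := pow_le_pow_left₀ (norm_nonneg _) h 2
  rw [norm_sub_smul_sq hφ lam] at hsq
  have h0 : (lam - ⟪x, φ⟫) ^ 2 = 0 := le_antisymm (by linarith) (sq_nonneg _)
  exact sub_eq_zero.mp (pow_eq_zero_iff two_ne_zero |>.mp h0)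

/-- If no two vectors of a set of unit vectors are orthogonal, then a greedy residual sequence
starting off the lines they span stays off these lines. -/
theorem greedy_residual_ne_smul {D : Set E} (hD : ∀ φ ∈ D, ‖φ‖ = 1)
    (hinner : ∀ φ ∈ D, ∀ ψ ∈ D, ⟪ψ, φ⟫ ≠ 0) (hne : D.Nonempty) {xs : ℕ → E}
    (hstart : ∀ ψ ∈ D, ¬ ∃ c : ℝ, xs 0 = c • ψ)
    (hstep : ∀ n, xs n ≠ 0 → ∃ φ ∈ D, ∃ lam : ℝ, xs (n + 1) = xs n - lam • φ ∧
      ∀ ψ ∈ D, ∀ t : ℝ, ‖xs n - lam • φ‖ ≤ ‖xs n - t • ψ‖) (n : ℕ) :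
    ∀ ψ ∈ D, ¬ ∃ c : ℝ, xs n = c • ψ := by
  induction n with
  | zero => exact hstart
  | succ n ih =>
    intro ψ hψ
    obtain ⟨χ, hχ⟩ := hne
    obtain ⟨φ, hφ, lam, hnext, hmin⟩ :=
      hstep n fun h0 => ih χ hχ ⟨0, by rw [h0, zero_smul]⟩
    rw [hnext, eq_inner_of_norm_sub_smul_le (hD φ hφ) (hmin φ hφ _)]
    exact residual_ne_smul (hD φ hφ) (hinner φ hφ ψ hψ) (ih φ hφ)

end Residual

/-- For the non-monotone dictionary `{(1,0), (1/√2, 1/√2)}` of the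
Euclidean plane, if `x` is not a multiple of either dictionary vector then each
best one-term residual `x − ⟨x,φ⟩φ` is nonzero and again not a multiple of either
dictionary vector; consequently every XGA residual sequence starting at `x`
never terminates. -/
theorem stmt_5 (φ₁ φ₂ : EuclideanSpace ℝ (Fin 2))
    (hφ₁ : φ₁ 0 = 1 ∧ φ₁ 1 = 0)
    (hφ₂ : φ₂ 0 = 1 / Real.sqrt 2 ∧ φ₂ 1 = 1 / Real.sqrt 2)
    (x : EuclideanSpace ℝ (Fin 2))
    (hx1 : ¬ ∃ c : ℝ, x = c • φ₁) (hx2 : ¬ ∃ c : ℝ, x = c • φ₂) :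
    (∀ φ ∈ ({φ₁, φ₂} : Set (EuclideanSpace ℝ (Fin 2))),
      x - ⟪x, φ⟫ • φ ≠ 0 ∧
      (¬ ∃ c : ℝ, x - ⟪x, φ⟫ • φ = c • φ₁) ∧
      (¬ ∃ c : ℝ, x - ⟪x, φ⟫ • φ = c • φ₂)) ∧
    (∀ xs : ℕ → EuclideanSpace ℝ (Fin 2), xs 0 = x →
      (∀ n : ℕ,
        (xs n ≠ 0 → ∃ φ ∈ ({φ₁, φ₂} : Set (EuclideanSpace ℝ (Fin 2))), ∃ lam : ℝ,
          xs (n + 1) = xs n - lam • φ ∧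
          ∀ ψ ∈ ({φ₁, φ₂} : Set (EuclideanSpace ℝ (Fin 2))), ∀ t : ℝ,
            ‖xs n - lam • φ‖ ≤ ‖xs n - t • ψ‖) ∧
        (xs n = 0 → xs (n + 1) = 0)) →
      ∀ n : ℕ, xs n ≠ 0) := by
  have hnorm₁ : ‖φ₁‖ = 1 := by simp [EuclideanSpace.norm_eq, hφ₁]
  have hnorm₂ : ‖φ₂‖ = 1 := by
    simp only [EuclideanSpace.norm_eq, Fin.sum_univ_two, hφ₂, Real.norm_eq_abs, sq_abs, div_pow,
      Real.sq_sqrt zero_le_two]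
    norm_num
  have h12 : ⟪φ₁, φ₂⟫ ≠ 0 := by simp [PiLp.inner_apply, hφ₁, hφ₂]
  have hD : ∀ φ ∈ ({φ₁, φ₂} : Set (EuclideanSpace ℝ (Fin 2))), ‖φ‖ = 1 := by
    rintro φ (rfl | rfl)
    exacts [hnorm₁, hnorm₂]
  have hinner : ∀ φ ∈ ({φ₁, φ₂} : Set (EuclideanSpace ℝ (Fin 2))),
      ∀ ψ ∈ ({φ₁, φ₂} : Set (EuclideanSpace ℝ (Fin 2))), ⟪ψ, φ⟫ ≠ 0 := by
    rintro φ (rfl | rfl) ψ (rfl | rfl)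
    · rw [real_inner_self_eq_norm_sq, hnorm₁]
      norm_num
    · rwa [real_inner_comm]
    · exact h12
    · rw [real_inner_self_eq_norm_sq, hnorm₂]
      norm_num
  have hx : ∀ ψ ∈ ({φ₁, φ₂} : Set (EuclideanSpace ℝ (Fin 2))), ¬ ∃ c : ℝ, x = c • ψ := by
    rintro ψ (rfl | rfl)
    exacts [hx1, hx2]
  have hmem₁ : φ₁ ∈ ({φ₁, φ₂} : Set (EuclideanSpace ℝ (Fin 2))) := Or.inl rfl
  have hmem₂ : φ₂ ∈ ({φ₁, φ₂} : Set (EuclideanSpace ℝ (Fin 2))) := Or.inr rfl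
  refine ⟨fun φ hφ => ⟨fun h0 => hx φ hφ ⟨_, sub_eq_zero.mp h0⟩,
    residual_ne_smul (hD φ hφ) (hinner φ hφ φ₁ hmem₁) (hx φ hφ),
    residual_ne_smul (hD φ hφ) (hinner φ hφ φ₂ hmem₂) (hx φ hφ)⟩, ?_⟩
  intro xs hxs hstep n h0
  exact greedy_residual_ne_smul hD hinner ⟨φ₁, hmem₁⟩ (hxs ▸ hx) (fun n => (hstep n).1) n φ₁ hmem₁
    ⟨0, by rw [h0, zero_smul]⟩
end

section
/- Let 1 < p < ∞, let m ≥ 0 and let (a_i)_{i=0}^m be real scalars. For every 0 ≤ i_0 < m one has ‖Σ_{i=0}^{i_0} a_i h_i‖_{L_p[0,1]} ≤ ‖Σ_{i=0}^{m} a_i h_i‖_{L_p[0,1]}, with equality if and only if a_i = 0 for all i_0 < i ≤ m. In other words, the Haar system is a strictly monotone basic sequence in L_p[0,1]. -/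
open MeasureTheory

/-- The Haar functions on `[0,1]` (extended by `0` to all of `ℝ`): `haarFn 0` is the
indicator of `[0,1)` (i.e. `h₀ ≡ 1` on `[0,1]` up to the single point `1`), and for
`i = 2^n + k` with `0 ≤ k < 2^n` (so that `n = Nat.log 2 i`), `haarFn i` is `1` on
`[k/2^n, (2k+1)/2^(n+1))`, `-1` on `[(2k+1)/2^(n+1), (k+1)/2^n)` and `0` elsewhere. -/
noncomputable def haarFn (i : ℕ) : ℝ → ℝ :=
  if i = 0 then Set.indicator (Set.Ico (0 : ℝ) 1) 1
  else
    let n := Nat.log 2 i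
    let k := i - 2 ^ n
    fun t =>
      Set.indicator (Set.Ico ((k : ℝ) / 2 ^ n) ((2 * (k : ℝ) + 1) / 2 ^ (n + 1))) 1 t -
        Set.indicator (Set.Ico ((2 * (k : ℝ) + 1) / 2 ^ (n + 1)) (((k : ℝ) + 1) / 2 ^ n)) 1 t

/-- The `L_p[0,1]` norm of a function `f : ℝ → ℝ`. -/
noncomputable def pnorm (p : ℝ) (f : ℝ → ℝ) : ℝ :=
  (eLpNorm f (ENNReal.ofReal p) (volume.restrict (Set.Ico (0 : ℝ) 1))).toReal

/-- The `L_p`-normalized Haar function `h_i^{(p)} = h_i / ‖h_i‖_p`. -/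
noncomputable def haarFnP (p : ℝ) (i : ℕ) : ℝ → ℝ :=
  fun t => haarFn i t / pnorm p (haarFn i)

/-- The norming functional of a nonzero `y ∈ L_p[0,1]` applied to `g`:
`F_y(g) = ‖y‖_p^{1−p} ∫₀¹ sign(y(t)) |y(t)|^{p−1} g(t) dt`. -/
noncomputable def normingF (p : ℝ) (y g : ℝ → ℝ) : ℝ :=
  pnorm p y ^ (1 - p) *
    ∫ t in Set.Ico (0 : ℝ) 1, Real.sign (y t) * |y t| ^ (p - 1) * g t

/-- Strict midpoint convexity of `|·| ^ p`. -/
theorem two_mul_abs_rpow_lt {p : ℝ} (hp : 1 < p) (c : ℝ) {b : ℝ} (hb : b ≠ 0) :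
    2 * |c| ^ p < |c + b| ^ p + |c - b| ^ p := by
  rcases eq_or_ne c 0 with rfl | hc
  · have h : 0 < |b| ^ p := Real.rpow_pos_of_pos (abs_pos.2 hb) p
    rw [abs_zero, Real.zero_rpow (by linarith), zero_add, zero_sub, abs_neg]
    linarith
  · have hne : |c + b| ≠ |c - b| := fun h => by
      rcases abs_eq_abs.1 h with h | h
      · exact hb (by linarith)
      · exact hc (by linarith)
    have hconv := (strictConvexOn_rpow hp).2 (Set.mem_Ici.2 (abs_nonneg (c + b)))
      (Set.mem_Ici.2 (abs_nonneg (c - b))) hne (by norm_num : (0 : ℝ) < 1 / 2)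
      (by norm_num : (0 : ℝ) < 1 / 2) (by norm_num)
    simp only [smul_eq_mul] at hconv
    have hmid : |c| ≤ 1 / 2 * |c + b| + 1 / 2 * |c - b| := by
      have h := abs_add_le (c + b) (c - b)
      rw [show c + b + (c - b) = 2 * c by ring, abs_mul, abs_two] at h
      linarith
    have := Real.rpow_le_rpow (abs_nonneg c) hmid (by linarith : (0 : ℝ) ≤ p)
    linarith

/-- Every dyadic number of level at most `n` lies on one side of a dyadic interval of level `n`. -/
theorem dyadic_le_iff {l n k u : ℕ} (hln : l ≤ n) {t : ℝ}
    (ht : t ∈ Set.Ico ((k : ℝ) / 2 ^ n) (((k : ℝ) + 1) / 2 ^ n)) :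
    (u : ℝ) / 2 ^ l ≤ t ↔ u * 2 ^ (n - l) ≤ k := by
  have hn : (0 : ℝ) < 2 ^ n := by positivity
  have hu : (u : ℝ) / 2 ^ l = ((u * 2 ^ (n - l) : ℕ) : ℝ) / 2 ^ n := by
    obtain ⟨d, rfl⟩ := Nat.exists_eq_add_of_le hln
    rw [Nat.add_sub_cancel_left, pow_add]
    push_cast
    field_simp
  rw [hu]
  constructor
  · intro h
    have h' := h.trans_lt ht.2
    rw [div_lt_div_iff_of_pos_right hn] at h'
    exact Nat.lt_succ_iff.1 (by exact_mod_cast h')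
  · intro h
    refine le_trans ?_ ht.1
    gcongr

theorem haarFn_zero : haarFn 0 = Set.indicator (Set.Ico (0 : ℝ) 1) 1 := by
  simp [haarFn]

theorem haarFn_two_pow_add {n k : ℕ} (hk : k < 2 ^ n) (t : ℝ) :
    haarFn (2 ^ n + k) t =
      Set.indicator (Set.Ico ((k : ℝ) / 2 ^ n) ((2 * (k : ℝ) + 1) / 2 ^ (n + 1))) 1 t -
        Set.indicator (Set.Ico ((2 * (k : ℝ) + 1) / 2 ^ (n + 1)) (((k : ℝ) + 1) / 2 ^ n)) 1 t := by
  have hlog : Nat.log 2 (2 ^ n + k) = n :=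
    Nat.log_eq_of_pow_le_of_lt_pow (by omega) (by rw [pow_succ]; omega)
  have h0 : 2 ^ n + k ≠ 0 := by positivity
  simp only [haarFn, if_neg h0, hlog, Nat.add_sub_cancel_left]

theorem exists_eq_two_pow_add {i : ℕ} (hi : i ≠ 0) : ∃ n k : ℕ, k < 2 ^ n ∧ i = 2 ^ n + k := by
  have h1 := Nat.pow_log_le_self 2 hi
  have h2 := Nat.lt_pow_succ_log_self (b := 2) (by norm_num) i
  rw [pow_succ] at h2
  exact ⟨Nat.log 2 i, i - 2 ^ Nat.log 2 i, by omega, by omega⟩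

/-- A Haar function is constant on the support of every later Haar function. -/
theorem haarFn_eq_of_mem {j n k : ℕ} (hk : k < 2 ^ n) (hj : j < 2 ^ n + k) {s t : ℝ}
    (hs : s ∈ Set.Ico ((k : ℝ) / 2 ^ n) (((k : ℝ) + 1) / 2 ^ n))
    (ht : t ∈ Set.Ico ((k : ℝ) / 2 ^ n) (((k : ℝ) + 1) / 2 ^ n)) :
    haarFn j s = haarFn j t := by
  have side : ∀ u l : ℕ, l ≤ n → ((u : ℝ) / 2 ^ l ≤ s ↔ (u : ℝ) / 2 ^ l ≤ t) :=
    fun u l hl => (dyadic_le_iff hl hs).trans (dyadic_le_iff hl ht).symm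
  rcases eq_or_ne j 0 with rfl | hj0
  · have h0 := side 0 0 (Nat.zero_le n)
    have h1 := side 1 0 (Nat.zero_le n)
    simp only [Nat.cast_zero, Nat.cast_one, pow_zero, div_one] at h0 h1
    simp only [haarFn_zero, Set.indicator_apply, Set.mem_Ico, ← not_le, h0, h1, Pi.one_apply]
  · obtain ⟨l, u, hu, rfl⟩ := exists_eq_two_pow_add hj0
    rw [haarFn_two_pow_add hu, haarFn_two_pow_add hu]
    have hln : l ≤ n := by
      by_contra! h
      have := Nat.pow_le_pow_right (n := 2) (by norm_num) (Nat.succ_le_of_lt h)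
      rw [Nat.succ_eq_add_one, pow_succ] at this
      omega
    rcases hln.lt_or_eq with hlt | rfl
    · have h0 := side u l hln
      have h1 := side (2 * u + 1) (l + 1) hlt
      have h2 := side (u + 1) l hln
      push_cast at h0 h1 h2
      simp only [Set.indicator_apply, Set.mem_Ico, ← not_le, h0, h1, h2, Pi.one_apply]
    · have huk : ((u + 1 : ℕ) : ℝ) ≤ k := by exact_mod_cast (by omega : u + 1 ≤ k)
      push_cast at huk
      have hpos : (0 : ℝ) < 2 ^ l := by positivity
      have hright : ((u : ℝ) + 1) / 2 ^ l ≤ (k : ℝ) / 2 ^ l := by gcongr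
      have hmid : (2 * (u : ℝ) + 1) / 2 ^ (l + 1) ≤ ((u : ℝ) + 1) / 2 ^ l := by
        rw [pow_succ, div_le_div_iff₀ (by positivity) hpos]
        nlinarith
      have vanish : ∀ r ∈ Set.Ico ((k : ℝ) / 2 ^ l) (((k : ℝ) + 1) / 2 ^ l),
          Set.indicator (Set.Ico ((u : ℝ) / 2 ^ l) ((2 * (u : ℝ) + 1) / 2 ^ (l + 1))) 1 r -
            Set.indicator (Set.Ico ((2 * (u : ℝ) + 1) / 2 ^ (l + 1)) (((u : ℝ) + 1) / 2 ^ l)) 1 r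
              = (0 : ℝ) := by
        intro r hr
        have h1 : ((u : ℝ) + 1) / 2 ^ l ≤ r := hright.trans hr.1
        rw [Set.indicator_of_notMem (fun h => absurd h.2 (not_lt.2 (hmid.trans h1))),
          Set.indicator_of_notMem (fun h => absurd h.2 (not_lt.2 h1)), sub_zero]
      rw [vanish s hs, vanish t ht]

theorem measurable_haarFn (i : ℕ) : Measurable (haarFn i) := by
  rcases eq_or_ne i 0 with rfl | hi
  · rw [haarFn_zero]
    exact measurable_one.indicator measurableSet_Ico
  · obtain ⟨n, k, hk, rfl⟩ := exists_eq_two_pow_add hi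
    rw [funext (haarFn_two_pow_add hk)]
    exact (measurable_one.indicator measurableSet_Ico).sub
      (measurable_one.indicator measurableSet_Ico)

theorem abs_haarFn_le (i : ℕ) (t : ℝ) : |haarFn i t| ≤ 1 := by
  rcases eq_or_ne i 0 with rfl | hi
  · rw [haarFn_zero, Set.indicator_apply]
    split_ifs <;> simp
  · obtain ⟨n, k, hk, rfl⟩ := exists_eq_two_pow_add hi
    rw [haarFn_two_pow_add hk, Set.indicator_apply, Set.indicator_apply]
    split_ifs <;> simp

theorem memLp_sum_haarFn (q : ENNReal) (a : ℕ → ℝ) (s : Finset ℕ) :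
    MemLp (fun t => ∑ i ∈ s, a i * haarFn i t) q (volume.restrict (Set.Ico (0 : ℝ) 1)) :=
  memLp_finsetSum s fun i _ => MemLp.const_mul
    (MemLp.of_bound (measurable_haarFn i).aestronglyMeasurable 1
      (Filter.Eventually.of_forall (abs_haarFn_le i))) (a i)

theorem pnorm_eq_integral_rpow {p : ℝ} (hp : 0 < p) {f : ℝ → ℝ}
    (hf : MemLp f (ENNReal.ofReal p) (volume.restrict (Set.Ico (0 : ℝ) 1))) :
    pnorm p f = (∫ t in Set.Ico (0 : ℝ) 1, |f t| ^ p) ^ p⁻¹ := by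
  have hint : 0 ≤ ∫ t in Set.Ico (0 : ℝ) 1, |f t| ^ p :=
    integral_nonneg fun t => Real.rpow_nonneg (abs_nonneg _) p
  rw [pnorm, hf.eLpNorm_eq_integral_rpow_norm (by simpa using hp) ENNReal.ofReal_ne_top,
    ENNReal.toReal_ofReal hp.le, ENNReal.toReal_ofReal]
  · simp only [Real.norm_eq_abs]
  · exact Real.rpow_nonneg hint _

/-- Adding to `f` a step `±b` on the two halves of an interval on which `f` is constant. -/
theorem integral_abs_rpow_add_step {p : ℝ} {f : ℝ → ℝ} {x y z b c : ℝ}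
    (hxy : x ≤ y) (hyz : y ≤ z) (hmid : z - y = y - x) (hx : 0 ≤ x) (hz : z ≤ 1)
    (hfc : ∀ t ∈ Set.Ico x z, f t = c)
    (hf : IntegrableOn (fun t => |f t| ^ p) (Set.Ico (0 : ℝ) 1)) :
    ∫ t in Set.Ico (0 : ℝ) 1,
        |f t + b * (Set.indicator (Set.Ico x y) 1 t - Set.indicator (Set.Ico y z) 1 t)| ^ p =
      (∫ t in Set.Ico (0 : ℝ) 1, |f t| ^ p) +
        (y - x) * (|c + b| ^ p + |c - b| ^ p - 2 * |c| ^ p) := by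
  have hpt : ∀ t,
      |f t + b * (Set.indicator (Set.Ico x y) 1 t - Set.indicator (Set.Ico y z) 1 t)| ^ p =
        |f t| ^ p + (Set.indicator (Set.Ico x y) (fun _ => |c + b| ^ p - |c| ^ p) t +
          Set.indicator (Set.Ico y z) (fun _ => |c - b| ^ p - |c| ^ p) t) := by
    intro t
    by_cases hA : t ∈ Set.Ico x y
    · have hB : t ∉ Set.Ico y z := fun h => absurd h.1 (not_le.2 hA.2)
      simp [hA, hB, hfc t ⟨hA.1, hA.2.trans_le hyz⟩]
    · by_cases hB : t ∈ Set.Ico y z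
      · simp [hA, hB, hfc t ⟨hxy.trans hB.1, hB.2⟩, sub_eq_add_neg]
      · simp [hA, hB]
  have hind : ∀ u v d : ℝ, IntegrableOn (Set.indicator (Set.Ico u v) fun _ => d)
      (Set.Ico (0 : ℝ) 1) := fun u v d =>
    (integrable_const d).indicator measurableSet_Ico
  have hval : ∀ u v d : ℝ, 0 ≤ u → u ≤ v → v ≤ 1 →
      ∫ t in Set.Ico (0 : ℝ) 1, Set.indicator (Set.Ico u v) (fun _ => d) t = (v - u) * d := by
    intro u v d hu huv hv
    rw [setIntegral_indicator measurableSet_Ico,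
      Set.inter_eq_right.2 (Set.Ico_subset_Ico hu hv), setIntegral_const, smul_eq_mul,
      Real.volume_real_Ico_of_le huv]
  simp_rw [hpt]
  rw [integral_add hf (Integrable.fun_add (hind _ _ _) (hind _ _ _)),
    integral_add (hind _ _ _) (hind _ _ _),
    hval _ _ _ hx hxy (hyz.trans hz), hval _ _ _ (hx.trans hxy) hyz hz, hmid]
  ring

/-- Adding a nonzero multiple of the next Haar function strictly increases the norm. -/
theorem pnorm_sum_haarFn_lt_succ {p : ℝ} (hp : 1 < p) (a : ℕ → ℝ) {m : ℕ} (hm : m ≠ 0)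
    (ham : a m ≠ 0) :
    pnorm p (fun t => ∑ i ∈ Finset.range m, a i * haarFn i t) <
      pnorm p (fun t => ∑ i ∈ Finset.range (m + 1), a i * haarFn i t) := by
  have hp0 : 0 < p := by linarith
  have hmem := memLp_sum_haarFn (ENNReal.ofReal p) a
  rw [pnorm_eq_integral_rpow hp0 (hmem _), pnorm_eq_integral_rpow hp0 (hmem _)]
  refine Real.rpow_lt_rpow (integral_nonneg fun t => Real.rpow_nonneg (abs_nonneg _) p) ?_
    (inv_pos.2 hp0)
  obtain ⟨n, k, hk, rfl⟩ := exists_eq_two_pow_add hm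
  have hn : (0 : ℝ) < 2 ^ n := by positivity
  have hhalf : (2 * (k : ℝ) + 1) / 2 ^ (n + 1) = (k : ℝ) / 2 ^ n + 1 / 2 / 2 ^ n := by
    rw [pow_succ]
    field_simp
  have hright : ((k : ℝ) + 1) / 2 ^ n = (k : ℝ) / 2 ^ n + 1 / 2 / 2 ^ n + 1 / 2 / 2 ^ n := by
    ring
  have hlen : (0 : ℝ) < 1 / 2 / 2 ^ n := by positivity
  have hk1 : ((k : ℝ) + 1) / 2 ^ n ≤ 1 := by
    rw [div_le_one hn]
    exact_mod_cast hk
  have hint : IntegrableOn (fun t => |∑ i ∈ Finset.range (2 ^ n + k), a i * haarFn i t| ^ p)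
      (Set.Ico (0 : ℝ) 1) := by
    have := (hmem (Finset.range (2 ^ n + k))).integrable_norm_rpow
      (by simpa using hp0) ENNReal.ofReal_ne_top
    simpa only [IntegrableOn, ENNReal.toReal_ofReal hp0.le, Real.norm_eq_abs] using this
  simp_rw [Finset.sum_range_succ _ (2 ^ n + k), haarFn_two_pow_add hk]
  rw [integral_abs_rpow_add_step
    (c := ∑ i ∈ Finset.range (2 ^ n + k), a i * haarFn i ((k : ℝ) / 2 ^ n))
    (by linarith) (by linarith) (by linarith) (by positivity) hk1 ?_ hint]
  · have := two_mul_abs_rpow_lt hp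
      (∑ i ∈ Finset.range (2 ^ n + k), a i * haarFn i ((k : ℝ) / 2 ^ n)) ham
    exact lt_add_of_pos_right _ (mul_pos (by linarith) (by linarith))
  · intro t ht
    refine Finset.sum_congr rfl fun i hi => ?_
    rw [haarFn_eq_of_mem hk (Finset.mem_range.1 hi) ht
      (Set.left_mem_Ico.2 (by linarith))]

theorem monotone_pnorm_sum_haarFn {p : ℝ} (hp : 1 < p) (a : ℕ → ℝ) :
    Monotone fun m => pnorm p (fun t => ∑ i ∈ Finset.range (m + 1), a i * haarFn i t) := by
  refine monotone_nat_of_le_succ fun m => ?_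
  by_cases ham : a (m + 1) = 0
  · simp only [Finset.sum_range_succ _ (m + 1), ham, zero_mul, add_zero, le_refl]
  · exact (pnorm_sum_haarFn_lt_succ hp a m.succ_ne_zero ham).le

/-- the Haar system is a strictly monotone basic sequence in
`L_p[0,1]` for `1 < p < ∞`: partial sums have smaller norm, with equality iff
all the later coefficients vanish. -/
theorem stmt_9 (p : ℝ) (hp : 1 < p) (m : ℕ) (a : ℕ → ℝ) (i₀ : ℕ) (hi₀ : i₀ < m) :
    pnorm p (fun t => ∑ i ∈ Finset.range (i₀ + 1), a i * haarFn i t) ≤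
      pnorm p (fun t => ∑ i ∈ Finset.range (m + 1), a i * haarFn i t) ∧
    (pnorm p (fun t => ∑ i ∈ Finset.range (i₀ + 1), a i * haarFn i t) =
        pnorm p (fun t => ∑ i ∈ Finset.range (m + 1), a i * haarFn i t) ↔
      ∀ i : ℕ, i₀ < i → i ≤ m → a i = 0) := by
  have hmono := monotone_pnorm_sum_haarFn hp a
  refine ⟨hmono hi₀.le, fun heq i hi him => ?_, fun h => ?_⟩
  · by_contra hai
    obtain ⟨j, rfl⟩ := Nat.exists_eq_add_of_lt hi
    have h1 := hmono (Nat.le_add_right i₀ j)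
    have h2 := pnorm_sum_haarFn_lt_succ hp a (Nat.succ_ne_zero _) hai
    have h3 := hmono him
    exact absurd heq ((h1.trans_lt h2).trans_le h3).ne
  · congr 1
    funext t
    refine Finset.sum_subset (Finset.range_mono (by omega)) fun i hi hi' => ?_
    rw [Finset.mem_range] at hi hi'
    rw [h i (by omega) (by omega), zero_mul]
end

section
/- Let 1 < p < ∞ and m ≥ 0. There exists a positive integer N, depending only on p and m, such that for every x in the linear span of {h_i^{(p)} : 0 ≤ i ≤ m} in L_p[0,1], every XGA residual sequence (x_n)_{n≥0} for the dictionary {h_i^{(p)} : 0 ≤ i ≤ m} starting at x satisfies x_N = 0. -/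
open MeasureTheory

/-- `GreedyStep ν i c b` says that `b` arises from `c` by one step of the greedy algorithm for
the seminorm `ν` and the standard basis of `ι → ℝ`, using the `i`-th basis vector. -/
def GreedyStep {ι : Type*} [DecidableEq ι] (ν : Seminorm ℝ (ι → ℝ)) (i : ι) (c b : ι → ℝ) :
    Prop :=
  (∃ l : ℝ, b = c - Pi.single i l) ∧ ∀ (j : ι) (t : ℝ), ν b ≤ ν (c - Pi.single j t)

/-- Coordinatewise minimality in the `i`-th direction bounds the `i`-th coordinate by the
subsequent ones. -/
def TailDominated {m : ℕ} (ν : Seminorm ℝ (Fin (m + 1) → ℝ)) (C : ℝ) : Prop :=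
  ∀ (c : Fin (m + 1) → ℝ) (i : Fin (m + 1)), (∀ t : ℝ, ν c ≤ ν (c - Pi.single i t)) →
    |c i| ≤ C * ∑ j ∈ Finset.Ioi i, |c j|

section Greedy

variable {m : ℕ} {ν : Seminorm ℝ (Fin (m + 1) → ℝ)} {C : ℝ}

theorem TailDominated.eq_zero (h : TailDominated ν C) {c : Fin (m + 1) → ℝ}
    (hc : ∀ (i : Fin (m + 1)) (t : ℝ), ν c ≤ ν (c - Pi.single i t)) : c = 0 := by
  have key : ∀ i : Fin (m + 1), c i = 0 := by
    intro i
    induction i using WellFoundedGT.induction with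
    | ind i ih =>
      have h1 := h c i (hc i)
      rw [Finset.sum_eq_zero (fun j hj => by simp [ih j (Finset.mem_Ioi.1 hj)]), mul_zero] at h1
      exact abs_nonpos_iff.1 h1
  exact funext key

theorem TailDominated.eq_zero_of_seminorm_eq_zero (h : TailDominated ν C)
    {c : Fin (m + 1) → ℝ} (hc : ν c = 0) : c = 0 :=
  h.eq_zero fun i t => by rw [hc]; exact apply_nonneg ν _

theorem seminorm_continuous_of_finite {ι : Type*} [Fintype ι] (ν : Seminorm ℝ (ι → ℝ)) :
    Continuous ν :=
  ν.convexOn.locallyLipschitz.continuous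

theorem TailDominated.exists_norm_le (h : TailDominated ν C) :
    ∃ κ : ℝ, 0 < κ ∧ ∀ c, κ * ‖c‖ ≤ ν c := by
  have hcomp : IsCompact (Metric.sphere (0 : Fin (m + 1) → ℝ) 1) := isCompact_sphere 0 1
  obtain ⟨a, ha, hmin⟩ := hcomp.exists_isMinOn (NormedSpace.sphere_nonempty.2 zero_le_one)
    (seminorm_continuous_of_finite ν).continuousOn
  have ha1 : ‖a‖ = 1 := by simpa using ha
  have hapos : 0 < ν a := by
    refine lt_of_le_of_ne (apply_nonneg ν a) fun h0 => ?_
    have := h.eq_zero_of_seminorm_eq_zero h0.symm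
    simp [this] at ha1
  refine ⟨ν a, hapos, fun c => ?_⟩
  by_cases hc : c = 0
  · simp [hc]
  have hn : 0 < ‖c‖ := norm_pos_iff.2 hc
  have h1 : ν a ≤ ν (‖c‖⁻¹ • c) := hmin (by simp [norm_smul, hn.ne'])
  rw [map_smul_eq_mul, norm_inv, norm_norm, inv_mul_eq_div, le_div_iff₀ hn] at h1
  exact h1

theorem TailDominated.exists_contraction (h : TailDominated ν C) :
    ∃ δ : ℝ, 0 < δ ∧ δ ≤ 1 ∧ ∀ (i : Fin (m + 1)) (c b : Fin (m + 1) → ℝ),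
      GreedyStep ν i c b → ν b ≤ (1 - δ) * ν c := by
  have hν := seminorm_continuous_of_finite ν
  have hcomp : IsCompact (Metric.sphere (0 : Fin (m + 1) → ℝ) 1) := isCompact_sphere 0 1
  have hS : ∃ δ : ℝ, 0 < δ ∧ δ ≤ 1 ∧ ∀ c ∈ Metric.sphere (0 : Fin (m + 1) → ℝ) 1,
      ∃ (j : Fin (m + 1)) (t : ℝ), ν (c - Pi.single j t) ≤ (1 - δ) * ν c := by
    refine hcomp.induction_on (p := fun S => ∃ δ : ℝ, 0 < δ ∧ δ ≤ 1 ∧ ∀ c ∈ S,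
      ∃ (j : Fin (m + 1)) (t : ℝ), ν (c - Pi.single j t) ≤ (1 - δ) * ν c)
      ⟨1, one_pos, le_rfl, by simp⟩ ?_ ?_ ?_
    · rintro S T hST ⟨δ, h0, h1, hT⟩
      exact ⟨δ, h0, h1, fun c hc => hT c (hST hc)⟩
    · rintro S T ⟨δ, h0, h1, hS⟩ ⟨ε, k0, k1, hT⟩
      refine ⟨min δ ε, lt_min h0 k0, (min_le_left _ _).trans h1, ?_⟩
      rintro c (hc | hc)
      · obtain ⟨j, t, hjt⟩ := hS c hc
        refine ⟨j, t, hjt.trans ?_⟩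
        gcongr
        exact min_le_left _ _
      · obtain ⟨j, t, hjt⟩ := hT c hc
        refine ⟨j, t, hjt.trans ?_⟩
        gcongr
        exact min_le_right _ _
    · intro c hc
      have hc0 : c ≠ 0 := by rintro rfl; simp at hc
      obtain ⟨j, t, hjt⟩ : ∃ (j : Fin (m + 1)) (t : ℝ), ν (c - Pi.single j t) < ν c := by
        by_contra! hcon
        exact hc0 (h.eq_zero hcon)
      have hpos : 0 < ν c := (apply_nonneg ν _).trans_lt hjt
      obtain ⟨r, hr1, hr2⟩ := exists_between ((div_lt_one hpos).2 hjt)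
      have hr0 : 0 ≤ r := (div_nonneg (apply_nonneg ν _) hpos.le).trans hr1.le
      rw [div_lt_iff₀ hpos] at hr1
      refine ⟨{d | ν (d - Pi.single j t) < r * ν d}, ?_, 1 - r, by linarith, by linarith, ?_⟩
      · refine mem_nhdsWithin_of_mem_nhds (IsOpen.mem_nhds (isOpen_lt ?_ ?_) hr1)
        · exact hν.comp (continuous_id.sub continuous_const)
        · exact continuous_const.mul hν
      · intro d hd
        exact ⟨j, t, by rw [sub_sub_cancel]; exact le_of_lt hd⟩
  obtain ⟨δ, h0, h1, hδ⟩ := hS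
  refine ⟨δ, h0, h1, fun i c b hstep => ?_⟩
  by_cases hc : c = 0
  · have := hstep.2 i 0
    simp only [Pi.single_zero, sub_zero, hc, map_zero, mul_zero] at this ⊢
    exact this
  have hn : 0 < ‖c‖ := norm_pos_iff.2 hc
  obtain ⟨j, t, hjt⟩ := hδ (‖c‖⁻¹ • c) (by simp [norm_smul, hn.ne'])
  refine (hstep.2 j (‖c‖ * t)).trans ?_
  have e : c - Pi.single j (‖c‖ * t) = ‖c‖ • (‖c‖⁻¹ • c - Pi.single j t) := by
    rw [smul_sub, smul_inv_smul₀ hn.ne', ← smul_eq_mul, Pi.single_smul]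
  rw [e, map_smul_eq_mul, norm_norm]
  refine (mul_le_mul_of_nonneg_left hjt hn.le).trans (le_of_eq ?_)
  rw [map_smul_eq_mul, norm_inv, norm_norm]
  field_simp

theorem seminorm_single_eq (ν : Seminorm ℝ (Fin (m + 1) → ℝ)) (i : Fin (m + 1)) (l : ℝ) :
    ν (Pi.single i l) = |l| * ν (Pi.single i 1) := by
  rw [← Real.norm_eq_abs, ← map_smul_eq_mul, ← Pi.single_smul, smul_eq_mul, mul_one]

/-- A long enough stretch of nonzero greedy residuals uses an index `≥ L`. -/
theorem TailDominated.exists_pick_ge (h : TailDominated ν C) (L : ℕ) :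
    ∃ N : ℕ, ∀ (c : ℕ → Fin (m + 1) → ℝ) (i : ℕ → Fin (m + 1)),
      (∀ n < N, c n ≠ 0 ∧ GreedyStep ν (i n) (c n) (c (n + 1))) → ∃ n < N, L ≤ (i n : ℕ) := by
  obtain ⟨κ, hκ, hnorm⟩ := h.exists_norm_le
  obtain ⟨δ, hδ, hδ1, hdrop⟩ := h.exists_contraction
  induction L with
  | zero => exact ⟨1, fun c i _ => ⟨0, one_pos, Nat.zero_le _⟩⟩
  | succ L ih =>
    obtain ⟨N, hN⟩ := ih
    set B : ℝ := ∑ i, ν (Pi.single i 1) with hB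
    have hB0 : 0 ≤ B := Finset.sum_nonneg fun i _ => apply_nonneg ν _
    have hBi : ∀ i, ν (Pi.single i 1) ≤ B := fun i =>
      Finset.single_le_sum (f := fun i => ν (Pi.single i 1))
        (fun i _ => apply_nonneg ν _) (Finset.mem_univ i)
    set K : ℝ := 2 * |C| * B / δ * ((m + 1) / κ) with hK
    obtain ⟨T, hT⟩ : ∃ T : ℕ, (1 - δ) ^ T * K < 1 := by
      have h1 := (tendsto_pow_atTop_nhds_zero_of_lt_one (r := 1 - δ) (by linarith)
        (by linarith)).mul_const K
      rw [zero_mul] at h1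
      exact (h1.eventually_lt_const one_pos).exists
    refine ⟨2 * N + T + 1, fun c i hc => ?_⟩
    by_contra! hlt
    obtain ⟨n₁, hn₁, hL₁⟩ := hN c i fun n hn => hc n (by omega)
    obtain ⟨n₂, hn₂, hL₂⟩ := hN (fun n => c (n₁ + 1 + n)) (fun n => i (n₁ + 1 + n))
      fun n hn => hc (n₁ + 1 + n) (by omega)
    have hk₁ := hlt n₁ (by omega)
    have hk₂ := hlt (n₁ + 1 + n₂) (by omega)
    set k : Fin (m + 1) := i n₁ with hk
    have hkL : (k : ℕ) = L := by omega
    set q := n₁ + 1 + n₂ with hq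
    have hik : i q = k := Fin.ext (by omega)
    have hfix : ∀ n ≤ 2 * N + T + 1, ∀ j, k < j → c n j = c 0 j := by
      intro n
      induction n with
      | zero => exact fun _ _ _ => rfl
      | succ n ihn =>
        intro hn j hj
        obtain ⟨l, hl⟩ := (hc n (by omega)).2.1
        have hji : j ≠ i n := by
          have := hlt n (by omega)
          intro e
          rw [Fin.lt_def, e] at hj
          omega
        rw [hl, Pi.sub_apply, Pi.single_eq_of_ne hji, sub_zero]
        exact ihn (by omega) j hj
    set Γ : ℝ := ∑ j ∈ Finset.Ioi k, |c 0 j| with hΓ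
    have hΓ0 : 0 ≤ Γ := Finset.sum_nonneg fun _ _ => abs_nonneg _
    have hΓn : ∀ n ≤ 2 * N + T + 1, ∑ j ∈ Finset.Ioi k, |c n j| = Γ := fun n hn =>
      Finset.sum_congr rfl fun j hj => by rw [hfix n hn j (Finset.mem_Ioi.1 hj)]
    have hafter : ∀ n < 2 * N + T + 1, i n = k → |c (n + 1) k| ≤ |C| * Γ := by
      intro n hn hin
      obtain ⟨⟨l, hl⟩, hmin⟩ := (hc n hn).2
      have h1 := h (c (n + 1)) k fun t => by
        have := hmin k (l + t)
        rwa [Pi.single_add, ← sub_sub, ← hin, ← hl, hin] at this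
      rw [hΓn _ (by omega)] at h1
      exact h1.trans (mul_le_mul_of_nonneg_right (le_abs_self C) hΓ0)
    have hbd : ∀ n, n₁ + 1 + n ≤ 2 * N + T + 1 → |c (n₁ + 1 + n) k| ≤ |C| * Γ := by
      intro n
      induction n with
      | zero => exact fun hn => hafter n₁ (by omega) rfl
      | succ n ihn =>
        intro hn
        by_cases hin : i (n₁ + 1 + n) = k
        · exact hafter (n₁ + 1 + n) (by omega) hin
        · obtain ⟨l, hl⟩ := (hc (n₁ + 1 + n) (by omega)).2.1
          rw [← add_assoc, hl, Pi.sub_apply, Pi.single_eq_of_ne (Ne.symm hin), sub_zero]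
          exact ihn (by omega)
    have hqν : δ * ν (c q) ≤ 2 * |C| * Γ * B := by
      have hstep := (hc q (by omega)).2
      have hd := hdrop _ _ _ hstep
      obtain ⟨l, hl⟩ := hstep.1
      have e : c q = c (q + 1) + Pi.single k l := by rw [hl, hik, sub_add_cancel]
      have h1 : ν (c q) ≤ ν (c (q + 1)) + |l| * ν (Pi.single k 1) := by
        rw [← seminorm_single_eq, e]
        exact map_add_le_add ν (c (q + 1)) (Pi.single k l)
      have h2 : |l| ≤ 2 * |C| * Γ := by
        have e2 : l = c q k - c (q + 1) k := by rw [e]; simp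
        have h3 := hbd n₂ (by omega)
        have h4 := hafter q (by omega) hik
        rw [e2]
        refine (abs_sub _ _).trans ?_
        linarith
      have h5 : |l| * ν (Pi.single k 1) ≤ 2 * |C| * Γ * B :=
        mul_le_mul h2 (hBi k) (apply_nonneg ν _) (by positivity)
      linarith
    have hpow : ∀ n, q + n ≤ 2 * N + T + 1 → ν (c (q + n)) ≤ (1 - δ) ^ n * ν (c q) := by
      intro n
      induction n with
      | zero => simp
      | succ n ihn =>
        intro hn
        refine (hdrop _ _ _ (hc (q + n) (by omega)).2).trans ?_
        rw [pow_succ', mul_assoc]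
        exact mul_le_mul_of_nonneg_left (ihn (by omega)) (by linarith)
    have hz := (hc (q + T) (by omega)).1
    have hzpos : 0 < ν (c (q + T)) :=
      (mul_pos hκ (norm_pos_iff.2 hz)).trans_le (hnorm _)
    have hΓle : Γ ≤ (m + 1) / κ * ν (c (q + T)) := by
      rw [← hΓn (q + T) (by omega)]
      calc ∑ j ∈ Finset.Ioi k, |c (q + T) j| ≤ ∑ j, |c (q + T) j| :=
            Finset.sum_le_sum_of_subset_of_nonneg (Finset.subset_univ _)
              fun _ _ _ => abs_nonneg _
        _ ≤ ∑ _j : Fin (m + 1), ‖c (q + T)‖ :=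
            Finset.sum_le_sum fun j _ => norm_le_pi_norm (c (q + T)) j
        _ = (m + 1) * ‖c (q + T)‖ := by simp
        _ ≤ (m + 1) * (ν (c (q + T)) / κ) := by
            gcongr
            rw [le_div_iff₀ hκ, mul_comm]
            exact hnorm _
        _ = _ := by ring
    have hqK : ν (c q) ≤ K * ν (c (q + T)) := by
      have : ν (c q) ≤ 2 * |C| * B / δ * Γ := by
        rw [div_mul_eq_mul_div, le_div_iff₀ hδ]
        linarith
      refine this.trans ?_
      rw [hK, mul_assoc (2 * |C| * B / δ)]
      exact mul_le_mul_of_nonneg_left hΓle (by positivity)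
    have hfin := (hpow T (by omega)).trans
      (mul_le_mul_of_nonneg_left hqK (pow_nonneg (by linarith) T))
    rw [← mul_assoc] at hfin
    nlinarith

/-- Uniform finite termination of the greedy algorithm in coordinates. -/
theorem TailDominated.exists_termination (h : TailDominated ν C) :
    ∃ N : ℕ, 0 < N ∧ ∀ c : ℕ → Fin (m + 1) → ℝ,
      (∀ n, c n ≠ 0 → ∃ i, GreedyStep ν i (c n) (c (n + 1))) →
      (∀ n, c n = 0 → c (n + 1) = 0) → c N = 0 := by
  obtain ⟨N, hN⟩ := h.exists_pick_ge (m + 1)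
  refine ⟨N + 1, N.succ_pos, fun c hstep hzero => ?_⟩
  by_contra hne
  have hne' : ∀ n ≤ N + 1, c n ≠ 0 := by
    intro n hn h0
    refine hne ?_
    generalize N + 1 = k at hn
    induction k, hn using Nat.le_induction with
    | base => exact h0
    | succ k _ ih => exact hzero k ih
  have : ∀ n, ∃ i, c n ≠ 0 → GreedyStep ν i (c n) (c (n + 1)) := by
    intro n
    by_cases hc : c n = 0
    · exact ⟨0, fun h0 => absurd hc h0⟩
    · obtain ⟨i, hi⟩ := hstep n hc
      exact ⟨i, fun _ => hi⟩
  choose i hi using this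
  obtain ⟨n, _, hn⟩ := hN c i fun n hn => ⟨hne' n (by omega), hi n (hne' n (by omega))⟩
  have := (i n).isLt
  omega

end Greedy

section HaarFunctions

theorem haarFn_of_ne_zero {i : ℕ} (hi : i ≠ 0) (t : ℝ) :
    haarFn i t = Set.indicator (Set.Ico (((i - 2 ^ Nat.log 2 i : ℕ) : ℝ) / 2 ^ Nat.log 2 i)
        ((2 * ((i - 2 ^ Nat.log 2 i : ℕ) : ℝ) + 1) / 2 ^ (Nat.log 2 i + 1))) 1 t -
      Set.indicator (Set.Ico ((2 * ((i - 2 ^ Nat.log 2 i : ℕ) : ℝ) + 1) / 2 ^ (Nat.log 2 i + 1))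
        ((((i - 2 ^ Nat.log 2 i : ℕ) : ℝ) + 1) / 2 ^ Nat.log 2 i)) 1 t := by
  rw [haarFn, if_neg hi]

theorem haarFn_eq_floor {i : ℕ} (hi : i ≠ 0) (t : ℝ) :
    haarFn i t =
      if ⌊(2 : ℝ) ^ (Nat.log 2 i + 1) * t⌋ = 2 * ((i - 2 ^ Nat.log 2 i : ℕ) : ℤ) then 1
      else if ⌊(2 : ℝ) ^ (Nat.log 2 i + 1) * t⌋ = 2 * ((i - 2 ^ Nat.log 2 i : ℕ) : ℤ) + 1 then -1
      else 0 := by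
  rw [haarFn_of_ne_zero hi]
  generalize Nat.log 2 i = n
  generalize i - 2 ^ n = k
  have e1 : t ∈ Set.Ico ((k : ℝ) / 2 ^ n) ((2 * (k : ℝ) + 1) / 2 ^ (n + 1)) ↔
      ⌊(2 : ℝ) ^ (n + 1) * t⌋ = 2 * (k : ℤ) := by
    rw [Int.floor_eq_iff, Set.mem_Ico, div_le_iff₀ (by positivity), lt_div_iff₀ (by positivity),
      pow_succ]
    push_cast
    constructor <;> rintro ⟨h1, h2⟩ <;> constructor <;> linarith
  have e2 : t ∈ Set.Ico ((2 * (k : ℝ) + 1) / 2 ^ (n + 1)) (((k : ℝ) + 1) / 2 ^ n) ↔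
      ⌊(2 : ℝ) ^ (n + 1) * t⌋ = 2 * (k : ℤ) + 1 := by
    rw [Int.floor_eq_iff, Set.mem_Ico, div_le_iff₀ (by positivity), lt_div_iff₀ (by positivity),
      pow_succ]
    push_cast
    constructor <;> rintro ⟨h1, h2⟩ <;> constructor <;> linarith
  simp only [Set.indicator_apply, e1, e2, Pi.one_apply]
  split_ifs <;> first | omega | norm_num

theorem haarFn_eq_zero_or (i : ℕ) (t : ℝ) : haarFn i t = 0 ∨ haarFn i t = 1 ∨ haarFn i t = -1 := by
  by_cases hi : i = 0
  · subst hi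
    rw [haarFn_zero, Set.indicator_apply]
    split_ifs <;> simp
  · rw [haarFn_eq_floor hi]
    split_ifs <;> simp

theorem memLp_haarFn (i : ℕ) (q : ENNReal) :
    MemLp (haarFn i) q (volume.restrict (Set.Ico (0 : ℝ) 1)) :=
  MemLp.of_bound (measurable_haarFn i).aestronglyMeasurable 1
    (Filter.Eventually.of_forall (abs_haarFn_le i))

theorem floor_of_haarFn_ne_zero {i : ℕ} (hi : i ≠ 0) {t : ℝ} (ht : haarFn i t ≠ 0) :
    ⌊(2 : ℝ) ^ Nat.log 2 i * t⌋ = ((i - 2 ^ Nat.log 2 i : ℕ) : ℤ) := by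
  rw [haarFn_eq_floor hi] at ht
  have e : (2 : ℝ) ^ Nat.log 2 i * t = (2 : ℝ) ^ (Nat.log 2 i + 1) * t / (2 : ℕ) := by
    rw [pow_succ]; push_cast; ring
  rw [e, Int.floor_div_natCast]
  split_ifs at ht with h1 h2
  · rw [h1]; omega
  · rw [h2]; omega
  · exact absurd rfl ht

theorem sub_two_pow_log_lt {i : ℕ} : i - 2 ^ Nat.log 2 i < 2 ^ Nat.log 2 i := by
  have h1 := Nat.lt_pow_succ_log_self (b := 2) one_lt_two i
  have h2 : 0 < 2 ^ Nat.log 2 i := by positivity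
  rw [pow_succ] at h1
  omega

theorem mem_Ico_of_haarFn_ne_zero {i : ℕ} {t : ℝ} (ht : haarFn i t ≠ 0) :
    t ∈ Set.Ico (0 : ℝ) 1 := by
  by_cases hi : i = 0
  · subst hi
    rw [haarFn_zero] at ht
    exact Set.mem_of_indicator_ne_zero ht
  · have h := floor_of_haarFn_ne_zero hi ht
    have hk : ((i - 2 ^ Nat.log 2 i : ℕ) : ℝ) + 1 ≤ 2 ^ Nat.log 2 i := by
      exact_mod_cast Nat.succ_le_of_lt (sub_two_pow_log_lt (i := i))
    rw [Int.floor_eq_iff] at h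
    push_cast only [Int.cast_natCast] at h
    have h2 : (0 : ℝ) < 2 ^ Nat.log 2 i := by positivity
    constructor
    · exact nonneg_of_mul_nonneg_right ((Nat.cast_nonneg _).trans h.1) h2
    · have := h.2.trans_le hk
      by_contra! hcon
      nlinarith

theorem haarFn_eq_of_lt {i j : ℕ} (hji : j < i) {s t : ℝ} (hs : haarFn i s ≠ 0)
    (ht : haarFn i t ≠ 0) : haarFn j s = haarFn j t := by
  by_cases hj : j = 0
  · subst hj
    rw [haarFn_zero, Set.indicator_of_mem (mem_Ico_of_haarFn_ne_zero hs),
      Set.indicator_of_mem (mem_Ico_of_haarFn_ne_zero ht)]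
    rfl
  have hi : i ≠ 0 := by omega
  have fs := floor_of_haarFn_ne_zero hi hs
  have ft := floor_of_haarFn_ne_zero hi ht
  rcases (Nat.log_mono_right (b := 2) hji.le).lt_or_eq with hlt | heq
  · have key : ∀ u : ℝ, ⌊(2 : ℝ) ^ (Nat.log 2 j + 1) * u⌋ =
        ⌊(2 : ℝ) ^ Nat.log 2 i * u⌋ / ((2 ^ (Nat.log 2 i - (Nat.log 2 j + 1)) : ℕ) : ℤ) := by
      intro u
      rw [← Int.floor_div_natCast]
      congr 1
      push_cast
      rw [eq_div_iff (by positivity), mul_right_comm, ← pow_add]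
      congr 3
      omega
    rw [haarFn_eq_floor hj, haarFn_eq_floor hj, key, key, fs, ft]
  · have zero : ∀ u : ℝ, haarFn i u ≠ 0 → haarFn j u = 0 := by
      intro u hu
      by_contra hne
      have h1 := floor_of_haarFn_ne_zero hj hne
      rw [heq, floor_of_haarFn_ne_zero hi hu] at h1
      have h2 := Nat.pow_log_le_self 2 hj
      rw [heq] at h2
      omega
    rw [zero s hs, zero t ht]

theorem exists_Ico_haarFn_ne_zero (i : ℕ) :
    ∃ a b : ℝ, a < b ∧ ∀ t ∈ Set.Ico a b, haarFn i t ≠ 0 := by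
  by_cases hi : i = 0
  · subst hi
    refine ⟨0, 1, one_pos, fun t ht => ?_⟩
    rw [haarFn_zero, Set.indicator_of_mem ht]
    exact one_ne_zero
  · refine ⟨((i - 2 ^ Nat.log 2 i : ℕ) : ℝ) / 2 ^ Nat.log 2 i,
      (2 * ((i - 2 ^ Nat.log 2 i : ℕ) : ℝ) + 1) / 2 ^ (Nat.log 2 i + 1), ?_, fun t ht => ?_⟩
    · rw [div_lt_div_iff₀ (by positivity) (by positivity), pow_succ]
      have : (0 : ℝ) < 2 ^ Nat.log 2 i := by positivity
      linarith
    · rw [haarFn_of_ne_zero hi, Set.indicator_of_mem ht,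
        Set.indicator_of_notMem (fun h => absurd ht.2 (not_lt.2 h.1))]
      simp

theorem measure_support_haarFn_pos (i : ℕ) :
    0 < volume.restrict (Set.Ico (0 : ℝ) 1) (Function.support (haarFn i)) := by
  obtain ⟨a, b, hab, hne⟩ := exists_Ico_haarFn_ne_zero i
  have hsub : Set.Ico a b ⊆ Function.support (haarFn i) := hne
  refine lt_of_lt_of_le ?_ (measure_mono hsub)
  rw [Measure.restrict_apply measurableSet_Ico,
    Set.inter_eq_left.2 fun t ht => mem_Ico_of_haarFn_ne_zero (hne t ht), Real.volume_Ico]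
  simpa using hab

theorem integral_haarFn {i : ℕ} (hi : i ≠ 0) : ∫ t in Set.Ico (0 : ℝ) 1, haarFn i t = 0 := by
  rw [setIntegral_eq_integral_of_forall_compl_eq_zero fun t ht => by
    by_contra h
    exact ht (mem_Ico_of_haarFn_ne_zero h)]
  simp_rw [haarFn_of_ne_zero hi]
  generalize Nat.log 2 i = n
  generalize i - 2 ^ n = k
  rw [integral_sub, integral_indicator_one measurableSet_Ico,
    integral_indicator_one measurableSet_Ico, Real.volume_real_Ico, Real.volume_real_Ico,
    pow_succ]
  · have e1 : (2 * (k : ℝ) + 1) / (2 ^ n * 2) - k / 2 ^ n = 1 / (2 ^ n * 2) := by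
      field_simp
      ring
    have e2 : ((k : ℝ) + 1) / 2 ^ n - (2 * k + 1) / (2 ^ n * 2) = 1 / (2 ^ n * 2) := by
      field_simp
      ring
    rw [e1, e2, sub_self]
  · exact (integrable_indicator_iff measurableSet_Ico).2 (integrableOn_const measure_Ico_lt_top.ne)
  · exact (integrable_indicator_iff measurableSet_Ico).2 (integrableOn_const measure_Ico_lt_top.ne)

end HaarFunctions

section Norm

theorem strictMono_deriv_abs_rpow {p : ℝ} (hp : 1 < p) :
    StrictMono fun x : ℝ => p * |x| ^ (p - 2) * x := by
  have pos : ∀ x : ℝ, 0 < x → p * |x| ^ (p - 2) * x = p * x ^ (p - 1) := by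
    intro x hx
    rw [abs_of_pos hx, mul_assoc, ← Real.rpow_add_one hx.ne']
    ring_nf
  have lt_of_nonneg : ∀ x y : ℝ, 0 ≤ x → x < y →
      p * |x| ^ (p - 2) * x < p * |y| ^ (p - 2) * y := by
    intro x y hx hxy
    rcases hx.eq_or_lt with rfl | hx
    · have : 0 < |y| := abs_pos.2 hxy.ne'
      rw [mul_zero]
      positivity
    · rw [pos x hx, pos y (hx.trans hxy)]
      exact mul_lt_mul_of_pos_left (Real.rpow_lt_rpow hx.le hxy (by linarith)) (by linarith)
  intro x y hxy
  change p * |x| ^ (p - 2) * x < p * |y| ^ (p - 2) * y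
  rcases le_or_gt 0 x with hx | hx
  · exact lt_of_nonneg x y hx hxy
  rcases le_or_gt y 0 with hy | hy
  · have := lt_of_nonneg (-y) (-x) (by linarith) (by linarith)
    simp only [abs_neg] at this
    linarith
  · have h1 := lt_of_nonneg 0 y le_rfl hy
    have h2 := lt_of_nonneg 0 (-x) le_rfl (by linarith)
    simp only [abs_neg, mul_zero] at h1 h2
    linarith

theorem deriv_mul_lt_abs_rpow_sub {p a z d : ℝ} (hp : 1 < p) (hd : 0 < d) (h : a ≤ z - d) :
    p * |a| ^ (p - 2) * a * d < |z| ^ p - |z - d| ^ p := by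
  obtain ⟨ξ, hξ, e⟩ := exists_hasDerivAt_eq_slope (fun x : ℝ => |x| ^ p)
    (fun x => p * |x| ^ (p - 2) * x) (show z - d < z by linarith)
    (fun x _ => (hasDerivAt_abs_rpow x hp).continuousAt.continuousWithinAt)
    (fun x _ => hasDerivAt_abs_rpow x hp)
  rw [sub_sub_cancel, eq_div_iff hd.ne'] at e
  rw [← e]
  exact mul_lt_mul_of_pos_right (strictMono_deriv_abs_rpow hp (h.trans_lt hξ.1)) hd

theorem pnorm_eq_integral {p : ℝ} (hp : 1 < p) {f : ℝ → ℝ}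
    (hf : MemLp f (ENNReal.ofReal p) (volume.restrict (Set.Ico (0 : ℝ) 1))) :
    pnorm p f = (∫ t in Set.Ico (0 : ℝ) 1, |f t| ^ p) ^ p⁻¹ := by
  have h0 : ENNReal.ofReal p ≠ 0 := by simp; linarith
  rw [pnorm, hf.eLpNorm_eq_integral_rpow_norm h0 ENNReal.ofReal_ne_top,
    ENNReal.toReal_ofReal (by positivity), ENNReal.toReal_ofReal (by linarith)]
  rfl

/-- Moving `f` along a sign function `h` towards a constant `a` strictly decreases the norm,
provided that `h` has mean zero or `a = 0`. -/
theorem pnorm_sub_lt {p a d : ℝ} {f h : ℝ → ℝ} (hp : 1 < p) (hd : 0 < d)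
    (hf : MemLp f (ENNReal.ofReal p) (volume.restrict (Set.Ico (0 : ℝ) 1)))
    (hh : MemLp h (ENNReal.ofReal p) (volume.restrict (Set.Ico (0 : ℝ) 1)))
    (hval : ∀ t, h t = 0 ∨ h t = 1 ∨ h t = -1)
    (hsupp : 0 < volume.restrict (Set.Ico (0 : ℝ) 1) (Function.support h))
    (ha : a = 0 ∨ ∫ t in Set.Ico (0 : ℝ) 1, h t = 0)
    (hfar : ∀ t, h t ≠ 0 → d ≤ (f t - a) * h t) :
    pnorm p (fun t => f t - d * h t) < pnorm p f := by
  have hp1 : 1 ≤ ENNReal.ofReal p := by simpa using hp.le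
  have hp0 : ENNReal.ofReal p ≠ 0 := (zero_lt_one.trans_le hp1).ne'
  have hg : MemLp (fun t => f t - d * h t) (ENNReal.ofReal p)
      (volume.restrict (Set.Ico (0 : ℝ) 1)) := hf.sub (hh.const_mul d)
  have int : ∀ {u : ℝ → ℝ}, MemLp u (ENNReal.ofReal p) (volume.restrict (Set.Ico (0 : ℝ) 1)) →
      Integrable (fun t => |u t| ^ p) (volume.restrict (Set.Ico (0 : ℝ) 1)) := by
    intro u hu
    have := hu.integrable_norm_rpow hp0 ENNReal.ofReal_ne_top
    rwa [ENNReal.toReal_ofReal (by linarith)] at this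
  set g : ℝ := p * |a| ^ (p - 2) * a with hgdef
  have pt : ∀ t, h t ≠ 0 → g * d * h t < |f t| ^ p - |f t - d * h t| ^ p := by
    intro t ht
    have hft := hfar t ht
    rcases hval t with h0 | h1 | h1
    · exact absurd h0 ht
    · rw [h1, mul_one] at hft ⊢
      rw [mul_one]
      exact deriv_mul_lt_abs_rpow_sub hp hd (by linarith)
    · rw [h1] at hft ⊢
      have := deriv_mul_lt_abs_rpow_sub (a := -a) (z := -f t) hp hd (by linarith)
      rw [abs_neg, abs_neg, ← abs_neg (-f t - d)] at this
      rw [show f t - d * -1 = -(-f t - d) by ring]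
      linarith
  have pt0 : ∀ t, h t = 0 → |f t| ^ p - |f t - d * h t| ^ p - g * d * h t = 0 := by
    intro t ht
    simp [ht]
  have hD : Integrable (fun t => |f t| ^ p - |f t - d * h t| ^ p)
      (volume.restrict (Set.Ico (0 : ℝ) 1)) := (int hf).sub (int hg)
  have hI : Integrable (fun t => |f t| ^ p - |f t - d * h t| ^ p - g * d * h t)
      (volume.restrict (Set.Ico (0 : ℝ) 1)) := hD.sub ((hh.integrable hp1).const_mul (g * d))
  have hpos : 0 < ∫ t in Set.Ico (0 : ℝ) 1,
      (|f t| ^ p - |f t - d * h t| ^ p - g * d * h t) := by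
    refine (integral_pos_iff_support_of_nonneg (fun t => ?_) hI).2 (hsupp.trans_le
      (measure_mono fun t ht => ?_))
    · by_cases ht : h t = 0
      · exact (pt0 t ht).ge
      · have := pt t ht
        simp only [Pi.zero_apply]
        linarith
    · have := pt t ht
      exact (show (0 : ℝ) < |f t| ^ p - |f t - d * h t| ^ p - g * d * h t by linarith).ne'
  rw [integral_sub hD ((hh.integrable hp1).const_mul (g * d)),
    integral_sub (int hf) (int hg), integral_const_mul] at hpos
  have hz : g * d * ∫ t in Set.Ico (0 : ℝ) 1, h t = 0 := by
    rcases ha with ha | ha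
    · simp [hgdef, ha]
    · rw [ha, mul_zero]
  rw [hz, sub_zero, sub_pos] at hpos
  rw [pnorm_eq_integral hp hf, pnorm_eq_integral hp hg]
  exact Real.rpow_lt_rpow (integral_nonneg fun t => by positivity) hpos
    (inv_pos.2 (by linarith))

end Norm

section HaarSystem

theorem pnorm_haarFn_pos {p : ℝ} (hp : 1 < p) (i : ℕ) : 0 < pnorm p (haarFn i) := by
  have h0 : ENNReal.ofReal p ≠ 0 := by simp; linarith
  refine ENNReal.toReal_pos (fun h => ?_) (memLp_haarFn i _).eLpNorm_ne_top
  rw [eLpNorm_eq_zero_iff (measurable_haarFn i).aestronglyMeasurable h0] at h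
  exact (measure_support_haarFn_pos i).ne' h

/-- The linear combination of `h_0^{(p)}, …, h_m^{(p)}` with given coefficients. -/
noncomputable def haarSum (p : ℝ) (m : ℕ) : (Fin (m + 1) → ℝ) →ₗ[ℝ] (ℝ → ℝ) :=
  Fintype.linearCombination ℝ fun i : Fin (m + 1) => haarFnP p i

variable {p : ℝ} {m : ℕ}

theorem haarSum_apply (c : Fin (m + 1) → ℝ) (t : ℝ) :
    haarSum p m c t = ∑ i, c i * haarFnP p i t := by
  simp [haarSum, Fintype.linearCombination_apply]

theorem haarSum_sub_single (c : Fin (m + 1) → ℝ) (i : Fin (m + 1)) (l : ℝ) :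
    haarSum p m (c - Pi.single i l) = fun t => haarSum p m c t - l * haarFnP p i t := by
  ext t
  simp [haarSum, Fintype.linearCombination_apply_single]

theorem memLp_haarSum (c : Fin (m + 1) → ℝ) (q : ENNReal) :
    MemLp (haarSum p m c) q (volume.restrict (Set.Ico (0 : ℝ) 1)) := by
  rw [funext (haarSum_apply c)]
  refine memLp_finsetSum _ fun i _ =>
    ((memLp_haarFn i q).const_mul (c i / pnorm p (haarFn i))).ae_eq
      (Filter.Eventually.of_forall fun t => ?_)
  simp only [haarFnP]
  ring

/-- The `L_p` norm as a seminorm on coefficient vectors with respect to the Haar system. -/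
noncomputable def haarSeminorm (hp : 1 < p) (m : ℕ) : Seminorm ℝ (Fin (m + 1) → ℝ) :=
  Seminorm.of (fun c => pnorm p (haarSum p m c))
    (fun c d => by
      have hp1 : 1 ≤ ENNReal.ofReal p := by simpa using hp.le
      have hc := memLp_haarSum (p := p) c (ENNReal.ofReal p)
      have hd := memLp_haarSum (p := p) d (ENNReal.ofReal p)
      rw [map_add, pnorm, pnorm, pnorm,
        ← ENNReal.toReal_add hc.eLpNorm_ne_top hd.eLpNorm_ne_top]
      exact ENNReal.toReal_mono (ENNReal.add_ne_top.2 ⟨hc.eLpNorm_ne_top, hd.eLpNorm_ne_top⟩)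
        (eLpNorm_add_le hc.1 hd.1 hp1))
    (fun a c => by
      rw [map_smul, pnorm, pnorm, eLpNorm_const_smul, ENNReal.toReal_mul, toReal_enorm])

theorem haarSeminorm_apply (hp : 1 < p) (c : Fin (m + 1) → ℝ) :
    haarSeminorm hp m c = pnorm p (haarSum p m c) := rfl

/-- If no multiple of `h_i` improves `∑ c_j h_j^{(p)}`, then the coefficient of the unnormalized
function `h_i` is at most the sum of the absolute values of the subsequent ones. -/
theorem coeff_le_of_minimal (hp : 1 < p) (c : Fin (m + 1) → ℝ) (i : Fin (m + 1))
    (hmin : ∀ t : ℝ, haarSeminorm hp m c ≤ haarSeminorm hp m (c - Pi.single i t)) :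
    c i / pnorm p (haarFn i) ≤ ∑ j ∈ Finset.Ioi i, |c j| / pnorm p (haarFn j) := by
  have w : ∀ j : ℕ, 0 < pnorm p (haarFn j) := pnorm_haarFn_pos hp
  by_contra! hlt
  set U := ∑ j ∈ Finset.Ioi i, |c j| / pnorm p (haarFn j) with hU
  set d := c i / pnorm p (haarFn i) - U with hd
  obtain ⟨a₀, b₀, hab, hne⟩ := exists_Ico_haarFn_ne_zero i
  have ht₀ := hne a₀ ⟨le_rfl, hab⟩
  set a := ∑ j ∈ Finset.Iio i, c j * haarFnP p j a₀ with ha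
  have key := pnorm_sub_lt (a := a) (d := d) (f := haarSum p m c) (h := haarFn i) hp
    (sub_pos.2 hlt) (memLp_haarSum c _) (memLp_haarFn i _) (haarFn_eq_zero_or i)
    (measure_support_haarFn_pos i) ?_ ?_
  · refine absurd key (not_lt.2 ?_)
    have := hmin (d * pnorm p (haarFn i))
    rw [haarSeminorm_apply, haarSeminorm_apply, haarSum_sub_single] at this
    have e : ∀ t, d * pnorm p (haarFn i) * haarFnP p i t = d * haarFn i t := fun t => by
      rw [haarFnP, mul_assoc, mul_div_cancel₀ _ (w i).ne']
    simpa only [e] using this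
  · by_cases hi : (i : ℕ) = 0
    · left
      refine Finset.sum_eq_zero fun j hj => ?_
      have := Fin.lt_def.1 (Finset.mem_Iio.1 hj)
      omega
    · exact Or.inr (integral_haarFn hi)
  · intro t ht
    have hsplit : haarSum p m c t = a + c i / pnorm p (haarFn i) * haarFn i t +
        ∑ j ∈ Finset.Ioi i, c j * haarFnP p j t := by
      have ha' : a = ∑ j ∈ Finset.Iio i, c j * haarFnP p j t :=
        Finset.sum_congr rfl fun j hj => by
          rw [haarFnP, haarFnP, haarFn_eq_of_lt (Fin.lt_def.1 (Finset.mem_Iio.1 hj)) ht₀ ht]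
      have hi' : c i / pnorm p (haarFn i) * haarFn i t =
          ∑ j, if j = i then c j * haarFnP p j t else 0 := by
        rw [Finset.sum_ite_eq' Finset.univ i, if_pos (Finset.mem_univ i), haarFnP]
        ring
      rw [haarSum_apply, ha', hi', ← Finset.filter_gt_eq_Iio, ← Finset.filter_lt_eq_Ioi,
        Finset.sum_filter, Finset.sum_filter, ← Finset.sum_add_distrib, ← Finset.sum_add_distrib]
      refine Finset.sum_congr rfl fun j _ => ?_
      rcases lt_trichotomy j i with h | h | h
      · simp [h, h.ne, h.not_gt]
      · simp [h]
      · simp [h, h.ne', h.not_gt]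
    have hsq : haarFn i t * haarFn i t = 1 := by
      rcases haarFn_eq_zero_or i t with h | h | h
      · exact absurd h ht
      · simp [h]
      · simp [h]
    have htail : |(∑ j ∈ Finset.Ioi i, c j * haarFnP p j t) * haarFn i t| ≤ U := by
      rw [abs_mul]
      refine (mul_le_of_le_one_right (abs_nonneg _) (abs_haarFn_le i t)).trans ?_
      refine (Finset.abs_sum_le_sum_abs _ _).trans (Finset.sum_le_sum fun j _ => ?_)
      rw [haarFnP, abs_mul, abs_div, abs_of_pos (w j), ← mul_div_assoc]
      exact div_le_div_of_nonneg_right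
        (mul_le_of_le_one_right (abs_nonneg _) (abs_haarFn_le j t)) (w j).le
    have hlow := (abs_le.1 htail).1
    have e : (haarSum p m c t - a) * haarFn i t = c i / pnorm p (haarFn i) +
        (∑ j ∈ Finset.Ioi i, c j * haarFnP p j t) * haarFn i t := by
      rw [hsplit]
      linear_combination (c i / pnorm p (haarFn i)) * hsq
    rw [e]
    linarith

theorem tailDominated_haarSeminorm (hp : 1 < p) (m : ℕ) :
    TailDominated (haarSeminorm hp m)
      ((∑ i : Fin (m + 1), pnorm p (haarFn i)) * ∑ i : Fin (m + 1), (pnorm p (haarFn i))⁻¹) := by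
  have w : ∀ j : ℕ, 0 < pnorm p (haarFn j) := pnorm_haarFn_pos hp
  intro c i hmin
  have h1 := coeff_le_of_minimal hp c i hmin
  have h2 := coeff_le_of_minimal hp (-c) i fun t => by
    have := hmin (-t)
    rwa [map_neg_eq_map, ← neg_add', map_neg_eq_map, ← sub_neg_eq_add, ← Pi.single_neg]
  simp only [Pi.neg_apply, abs_neg] at h2
  have h3 : |c i| / pnorm p (haarFn i) ≤ ∑ j ∈ Finset.Ioi i, |c j| / pnorm p (haarFn j) := by
    rw [← abs_of_pos (w i), ← abs_div]
    rw [neg_div] at h2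
    exact abs_le'.2 ⟨h1, h2⟩
  rw [div_le_iff₀ (w i), mul_comm] at h3
  refine h3.trans ?_
  rw [mul_assoc]
  refine mul_le_mul (Finset.single_le_sum (f := fun i : Fin (m + 1) => pnorm p (haarFn i))
    (fun j _ => (w j).le) (Finset.mem_univ i)) ?_
    (Finset.sum_nonneg fun j _ => div_nonneg (abs_nonneg _) (w j).le)
    (Finset.sum_nonneg fun j _ => (w j).le)
  rw [Finset.mul_sum]
  refine Finset.sum_le_sum fun j _ => ?_
  rw [div_eq_inv_mul]
  exact mul_le_mul_of_nonneg_right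
    (Finset.single_le_sum (f := fun i : Fin (m + 1) => (pnorm p (haarFn i))⁻¹)
      (fun j _ => (inv_pos.2 (w j)).le) (Finset.mem_univ j)) (abs_nonneg _)

theorem haarSum_injective (hp : 1 < p) (m : ℕ) : Function.Injective (haarSum p m) := by
  rw [← LinearMap.ker_eq_bot, LinearMap.ker_eq_bot']
  intro c hc
  refine (tailDominated_haarSeminorm hp m).eq_zero_of_seminorm_eq_zero ?_
  rw [haarSeminorm_apply, hc, ← map_zero (haarSum p m), ← haarSeminorm_apply hp, map_zero]

end HaarSystem

/-- for `1 < p < ∞` and `m ≥ 0` there is a positive integer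
`N = N(p,m)` such that every XGA residual sequence for the dictionary
`{h_i^{(p)} : 0 ≤ i ≤ m}` in `L_p[0,1]`, starting at any vector of the linear
span of the dictionary, satisfies `x_N = 0`. -/
theorem stmt_12 (p : ℝ) (hp : 1 < p) (m : ℕ) :
    ∃ N : ℕ, 0 < N ∧
      ∀ (c : ℕ → ℝ) (x : ℕ → ℝ → ℝ),
        x 0 = (fun t => ∑ i ∈ Finset.range (m + 1), c i * haarFnP p i t) →
        (∀ n : ℕ,
          (x n ≠ 0 → ∃ i ≤ m, ∃ lam : ℝ,
            x (n + 1) = (fun t => x n t - lam * haarFnP p i t) ∧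
            ∀ j ≤ m, ∀ t : ℝ,
              pnorm p (fun s => x n s - lam * haarFnP p i s) ≤
                pnorm p (fun s => x n s - t * haarFnP p j s)) ∧
          (x n = 0 → x (n + 1) = 0)) →
        x N = 0 := by
  obtain ⟨N, hN, hterm⟩ := (tailDominated_haarSeminorm hp m).exists_termination
  refine ⟨N, hN, fun c x hx0 hx => ?_⟩
  have hspan : ∀ n, ∃ b : Fin (m + 1) → ℝ, x n = haarSum p m b := by
    intro n
    induction n with
    | zero =>
      refine ⟨fun i => c i, ?_⟩
      rw [hx0]
      ext t
      rw [haarSum_apply, Finset.sum_range]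
    | succ n ih =>
      obtain ⟨b, hb⟩ := ih
      by_cases h0 : x n = 0
      · exact ⟨0, by rw [(hx n).2 h0, map_zero]⟩
      · obtain ⟨i, hi, l, hl, -⟩ := (hx n).1 h0
        exact ⟨b - Pi.single ⟨i, by omega⟩ l, by rw [hl, haarSum_sub_single, hb]⟩
  choose b hb using hspan
  have hzero : ∀ n, b n = 0 ↔ x n = 0 := fun n => by
    rw [hb n, ← map_zero (haarSum p m), (haarSum_injective hp m).eq_iff]
  refine (hzero N).1 (hterm b (fun n hn => ?_) fun n hn => ?_)
  · obtain ⟨i, hi, l, hl, hmin⟩ := (hx n).1 (mt (hzero n).2 hn)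
    have hstep : b (n + 1) = b n - Pi.single ⟨i, by omega⟩ l := by
      apply haarSum_injective hp m
      rw [haarSum_sub_single, ← hb, ← hb, hl]
    refine ⟨⟨i, by omega⟩, ⟨l, hstep⟩, fun j t => ?_⟩
    rw [haarSeminorm_apply, haarSeminorm_apply, hstep, haarSum_sub_single, haarSum_sub_single,
      ← hb]
    exact hmin j (by omega) t
  · exact (hzero _).2 ((hx n).2 ((hzero n).1 hn))
end
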